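/- arXiv:2603.18434 — 2 statements merged into one kernel-verified Lean document; each statement's English description precedes it below -/
import Mathlib

section
/- Lost Theorem (existence of brake orbits): fix h > 0 and let q₀ be a collision-free configuration lying in the Hill region, i.e., U(q₀) ≥ h. Then there exists a solution q(t) of Newton's N-body equations, defined on some open interval J ⊆ ℝ, with total energy E = −h, such that q(t₀) = q₀ for some t₀ ∈ J and such that the solution has a brake instant: there is a t* ∈ J with q̇_a(t*) = 0 for every a = 1, …, N. -/
open Finset Filter MeasureTheory
open scoped RealInnerProductSpace

noncomputable section

/-- Configuration space of `N` bodies in `ℝ³`. -/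
abbrev Config (N : ℕ) := Fin N → EuclideanSpace ℝ (Fin 3)

/-- A configuration is collision-free if all bodies occupy distinct positions. -/
def CollisionFree {N : ℕ} (q : Config N) : Prop :=
  ∀ a b : Fin N, a ≠ b → q a ≠ q b

/-- The Newtonian potential `U(q) = G ∑_{a<b} m_a m_b / |q_a - q_b|`. -/
def potU {N : ℕ} (G : ℝ) (m : Fin N → ℝ) (q : Config N) : ℝ :=
  G * ∑ a : Fin N, ∑ b : Fin N, if a < b then m a * m b / ‖q a - q b‖ else 0

/-- Kinetic energy `K = (1/2) ∑_a m_a |v_a|²`. -/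
def kinE {N : ℕ} (m : Fin N → ℝ) (v : Config N) : ℝ :=
  (1 / 2) * ∑ a : Fin N, m a * ‖v a‖ ^ 2

/-- Moment of inertia `I = ∑_a m_a |q_a|²`. -/
def momI {N : ℕ} (m : Fin N → ℝ) (q : Config N) : ℝ :=
  ∑ a : Fin N, m a * ‖q a‖ ^ 2

/-- `q, v : ℝ → Config N` is a solution of Newton's N-body equations on `J`:
at each time in `J` the configuration is collision-free, `v` is the derivative
of `q`, and the acceleration satisfies
`m_a q̈_a = G ∑_{b ≠ a} m_a m_b (q_b - q_a)/|q_b - q_a|³`. -/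
def IsSolutionOn {N : ℕ} (G : ℝ) (m : Fin N → ℝ) (J : Set ℝ)
    (q v : ℝ → Config N) : Prop :=
  ∀ t ∈ J,
    CollisionFree (q t) ∧
    (∀ a, HasDerivAt (fun s => q s a) (v t a) t) ∧
    (∀ a, ∃ acc : EuclideanSpace ℝ (Fin 3),
      HasDerivAt (fun s => v s a) acc t ∧
      m a • acc = ∑ b ∈ univ.filter (fun b => b ≠ a),
        (G * m a * m b / ‖q t b - q t a‖ ^ 3) • (q t b - q t a))

namespace Lost
open Set Topology
open scoped ENNReal NNReal

set_option linter.unusedSectionVars false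

abbrev P3 := EuclideanSpace ℝ (Fin 3)

lemma gauss_int (b : ℝ) (hb : 0 < b) :
    ∫⁻ ξ : P3, ENNReal.ofReal (Real.exp (-b * ‖ξ‖ ^ 2)) =
      ENNReal.ofReal ((Real.pi / b) ^ (3 / 2 : ℝ)) := by
  have h1 : ∫ ξ : P3, Real.exp (-b * ‖ξ‖ ^ 2) = (Real.pi / b) ^ (3 / 2 : ℝ) := by
    have := GaussianFourier.integral_rexp_neg_mul_sq_norm (V := P3) hb
    simpa using this
  have hpos : 0 < (Real.pi / b) ^ (3 / 2 : ℝ) := by positivity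
  rw [← h1, ofReal_integral_eq_lintegral_ofReal]
  · by_contra hI
    rw [integral_undef hI] at h1
    linarith
  · exact Eventually.of_forall fun ξ => (Real.exp_pos _).le

/-- gaussian probability measure on `ℝ³`. -/
def gam : Measure P3 := (volume : Measure P3).withDensity
  (fun ξ => ENNReal.ofReal ((Real.pi ^ (3 / 2 : ℝ))⁻¹ * Real.exp (-‖ξ‖ ^ 2)))

lemma gam_meas : Measurable (fun ξ : P3 =>
    ENNReal.ofReal ((Real.pi ^ (3 / 2 : ℝ))⁻¹ * Real.exp (-‖ξ‖ ^ 2))) := by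
  fun_prop

lemma lint_gam {f : P3 → ℝ≥0∞} (hf : Measurable f) :
    ∫⁻ ξ, f ξ ∂gam = ENNReal.ofReal ((Real.pi ^ (3 / 2 : ℝ))⁻¹) *
      ∫⁻ ξ, ENNReal.ofReal (Real.exp (-‖ξ‖ ^ 2)) * f ξ := by
  rw [gam, lintegral_withDensity_eq_lintegral_mul _ gam_meas hf, ← lintegral_const_mul]
  · congr 1; ext ξ
    simp only [Pi.mul_apply]
    rw [ENNReal.ofReal_mul (by positivity), mul_assoc]
  · fun_prop

instance : IsProbabilityMeasure gam := by
  constructor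
  have := lint_gam (f := fun _ => 1) measurable_const
  rw [lintegral_one] at this
  rw [this]
  have h := gauss_int 1 one_pos
  simp only [neg_mul, one_mul, div_one] at h
  simp only [mul_one]
  rw [h, ← ENNReal.ofReal_mul (by positivity), inv_mul_cancel₀ (by positivity), ENNReal.ofReal_one]

lemma gam_M2 : ∫⁻ ξ, ENNReal.ofReal (‖ξ‖ ^ 2) ∂gam ≠ ∞ := by
  rw [lint_gam (by fun_prop)]
  refine ENNReal.mul_ne_top ENNReal.ofReal_ne_top ?_
  have h := gauss_int (1/2) (by norm_num)
  have h2 : ∫⁻ ξ : P3, ENNReal.ofReal (Real.exp (-‖ξ‖ ^ 2)) * ENNReal.ofReal (‖ξ‖ ^ 2) ≤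
      ∫⁻ ξ : P3, ENNReal.ofReal 2 * ENNReal.ofReal (Real.exp (-(1/2) * ‖ξ‖ ^ 2)) := by
    refine lintegral_mono fun ξ => ?_
    rw [← ENNReal.ofReal_mul (by positivity), ← ENNReal.ofReal_mul (by positivity)]
    refine ENNReal.ofReal_le_ofReal ?_
    have e1 : Real.exp (-‖ξ‖ ^ 2) = Real.exp (-(1/2) * ‖ξ‖ ^ 2) * Real.exp (-(1/2) * ‖ξ‖ ^ 2) := by
      rw [← Real.exp_add]; ring_nf
    have e2 : Real.exp (-(1/2) * ‖ξ‖ ^ 2) * Real.exp ((1/2) * ‖ξ‖ ^ 2) = 1 := by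
      rw [← Real.exp_add]; simp
    have e3 := Real.add_one_le_exp ((1/2) * ‖ξ‖ ^ 2)
    have e4 := Real.exp_pos (-(1/2) * ‖ξ‖ ^ 2)
    rw [e1]
    set A := Real.exp (-(1/2) * ‖ξ‖ ^ 2)
    have : A * ‖ξ‖^2 ≤ 2 := by nlinarith
    nlinarith
  refine ne_top_of_le_ne_top ?_ h2
  rw [lintegral_const_mul _ (by fun_prop), h]
  exact ENNReal.mul_ne_top ENNReal.ofReal_ne_top ENNReal.ofReal_ne_top

/-- `1/|r|` as mixture of Gaussians. -/
lemma inv_mix (r : P3) : ‖r‖ₑ⁻¹ = ENNReal.ofReal (2 / √Real.pi) *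
    ∫⁻ u in Ioi (0:ℝ), ENNReal.ofReal (Real.exp (-‖r‖ ^ 2 * u ^ 2)) := by
  by_cases hr : r = 0
  · subst hr
    simp only [enorm_zero, ENNReal.inv_zero, norm_zero]
    simp
    have : 0 < √Real.pi := by positivity
    rw [ENNReal.mul_top]
    simp only [ne_eq, ENNReal.ofReal_eq_zero, not_le]; positivity
  · have hr' : 0 < ‖r‖ := norm_pos_iff.mpr hr
    have h1 := integral_gaussian_Ioi (‖r‖ ^ 2)
    have hpos : 0 < √(Real.pi / ‖r‖^2) / 2 := by positivity
    rw [← ofReal_integral_eq_lintegral_ofReal, h1, ← ENNReal.ofReal_mul (by positivity),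
      ← ofReal_norm, ← ENNReal.ofReal_inv_of_pos hr']
    · congr 1
      rw [Real.sqrt_div' _ (by positivity), Real.sqrt_sq hr'.le]
      have : 0 < √Real.pi := by positivity
      field_simp
    · by_contra hI
      rw [integral_undef hI] at h1
      linarith
    · exact Eventually.of_forall fun ξ => (Real.exp_pos _).le

lemma gauss_conv (r : P3) (s u : ℝ) :
    ∫⁻ ξ, ENNReal.ofReal (Real.exp (-‖r + s • ξ‖ ^ 2 * u ^ 2)) ∂gam =
      ENNReal.ofReal (((1 + s ^ 2 * u ^ 2) ^ (3 / 2 : ℝ))⁻¹) *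
        ENNReal.ofReal (Real.exp (-‖r‖ ^ 2 * (u / √(1 + s ^ 2 * u ^ 2)) ^ 2)) := by
  rw [lint_gam (by fun_prop)]
  set b := 1 + s ^ 2 * u ^ 2 with hb
  have hb0 : 0 < b := by positivity
  have h1 : ∀ ξ : P3, ENNReal.ofReal (Real.exp (-‖ξ‖ ^ 2)) *
      ENNReal.ofReal (Real.exp (-‖r + s • ξ‖ ^ 2 * u ^ 2)) =
      ENNReal.ofReal (Real.exp (-‖r‖ ^ 2 * (u / √b) ^ 2)) *
      ENNReal.ofReal (Real.exp (-b * ‖ξ + (s * u ^ 2 / b) • r‖ ^ 2)) := by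
    intro ξ
    rw [← ENNReal.ofReal_mul (by positivity), ← ENNReal.ofReal_mul (by positivity),
      ← Real.exp_add, ← Real.exp_add]
    congr 2
    rw [div_pow, Real.sq_sqrt hb0.le, norm_add_sq_real, norm_add_sq_real]
    simp only [norm_smul, real_inner_smul_right, real_inner_comm r ξ, mul_pow, norm_div,
      norm_mul, div_pow, norm_pow, Real.norm_eq_abs, sq_abs]
    field_simp
    rw [hb]; ring
  simp_rw [h1]
  rw [lintegral_const_mul _ (by fun_prop)]
  rw [lintegral_add_right_eq_self (fun ξ : P3 => ENNReal.ofReal (Real.exp (-b * ‖ξ‖ ^ 2)))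
    ((s * u ^ 2 / b) • r), gauss_int b hb0]
  rw [mul_left_comm, mul_comm]
  congr 1
  rw [← ENNReal.ofReal_mul (by positivity)]
  congr 1
  rw [Real.div_rpow (by positivity) (by positivity)]
  have : 0 < Real.pi ^ (3/2:ℝ) := by positivity
  field_simp

lemma kernel_aux (r : P3) (s : ℝ) (hs : s ≠ 0) :
    ∫⁻ ξ, ‖r + s • ξ‖ₑ⁻¹ ∂gam = ENNReal.ofReal (2 / √Real.pi) *
      ∫⁻ u in (fun u : ℝ => u / √(1 + s ^ 2 * u ^ 2)) '' Ioi 0,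
        ENNReal.ofReal (Real.exp (-‖r‖ ^ 2 * u ^ 2)) := by
  simp_rw [inv_mix]
  rw [lintegral_const_mul _ (by
    refine Measurable.lintegral_prod_right' (f := fun p : P3 × ℝ => ENNReal.ofReal (Real.exp (-‖r + s • p.1‖ ^ 2 * p.2 ^ 2))) (by fun_prop))]
  congr 1
  rw [lintegral_lintegral_swap (by
    refine Measurable.aemeasurable ?_
    simp only [Function.uncurry_def]
    fun_prop)]
  simp_rw [gauss_conv]
  have hd : ∀ u ∈ Ioi (0:ℝ), HasDerivWithinAt (fun u : ℝ => u / √(1 + s ^ 2 * u ^ 2))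
      (((1 + s ^ 2 * u ^ 2) ^ (3 / 2 : ℝ))⁻¹) (Ioi 0) u := by
    intro u _
    have hb0 : 0 < 1 + s ^ 2 * u ^ 2 := by positivity
    have h1 : HasDerivAt (fun u : ℝ => 1 + s ^ 2 * u ^ 2) (s ^ 2 * (2 * u)) u := by
      simpa using ((hasDerivAt_pow 2 u).const_mul (s^2)).const_add 1
    have h2 := (hasDerivAt_id u).div (h1.sqrt hb0.ne') (by positivity)
    refine (h2.congr_deriv ?_).hasDerivWithinAt
    have h3 : (1 + s ^ 2 * u ^ 2) ^ (3 / 2 : ℝ) = (1 + s ^ 2 * u ^ 2) * √(1 + s ^ 2 * u ^ 2) := by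
      rw [Real.sqrt_eq_rpow, show (3/2:ℝ) = 1 + 1/2 by norm_num, Real.rpow_add hb0, Real.rpow_one]
    rw [h3]
    have h4 : 0 < √(1 + s ^ 2 * u ^ 2) := by positivity
    have h5 := Real.sq_sqrt hb0.le
    simp only [id]
    field_simp
    rw [h5]; ring
  have hinj : InjOn (fun u : ℝ => u / √(1 + s ^ 2 * u ^ 2)) (Ioi 0) := by
    intro x hx y hy hxy
    have hx : 0 < x := hx
    have hy : 0 < y := hy
    simp only at hxy
    have h2 : (x / √(1 + s ^ 2 * x ^ 2)) ^ 2 = (y / √(1 + s ^ 2 * y ^ 2)) ^ 2 := by rw [hxy]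
    rw [div_pow, div_pow, Real.sq_sqrt (by positivity), Real.sq_sqrt (by positivity),
      div_eq_div_iff (by positivity) (by positivity)] at h2
    have : x ^ 2 = y ^ 2 := by nlinarith
    exact (pow_left_inj₀ hx.le hy.le (by norm_num)).mp this
  rw [lintegral_image_eq_lintegral_abs_deriv_mul measurableSet_Ioi hd hinj]
  refine lintegral_congr fun u => ?_
  rw [abs_of_pos (by positivity)]

lemma kernel_le_inv (r : P3) (s : ℝ) :
    ∫⁻ ξ, ‖r + s • ξ‖ₑ⁻¹ ∂gam ≤ ‖r‖ₑ⁻¹ := by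
  by_cases hs : s = 0
  · subst hs; simp
  rw [kernel_aux r s hs, inv_mix r]
  gcongr
  rintro _ ⟨u, hu, rfl⟩
  have hu : 0 < u := hu
  show 0 < u / _
  positivity

lemma kernel_le_scale (r : P3) (s : ℝ) (hs : s ≠ 0) :
    ∫⁻ ξ, ‖r + s • ξ‖ₑ⁻¹ ∂gam ≤ ENNReal.ofReal (2 / |s|) := by
  rw [kernel_aux r s hs]
  have hs' : 0 < |s| := abs_pos.mpr hs
  have h1 : ∫⁻ u in (fun u : ℝ => u / √(1 + s ^ 2 * u ^ 2)) '' Ioi 0,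
        ENNReal.ofReal (Real.exp (-‖r‖ ^ 2 * u ^ 2)) ≤ ∫⁻ u in Icc 0 (1 / |s|), 1 := by
    refine (lintegral_mono_set (t := Icc 0 (1 / |s|)) ?_).trans (lintegral_mono fun u => ?_)
    · rintro _ ⟨u, hu, rfl⟩
      have hu : 0 < u := hu
      refine ⟨by positivity, ?_⟩
      simp only
      rw [div_le_div_iff₀ (by positivity) hs', one_mul]
      refine Real.le_sqrt_of_sq_le ?_
      rw [mul_pow, sq_abs]; nlinarith
    · rw [← ENNReal.ofReal_one]
      refine ENNReal.ofReal_le_ofReal (Real.exp_le_one_iff.mpr ?_)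
      nlinarith [mul_nonneg (sq_nonneg ‖r‖) (sq_nonneg u)]
  refine (mul_le_mul_right h1 _).trans ?_
  rw [setLIntegral_one, Real.volume_Icc, sub_zero, ← ENNReal.ofReal_mul (by positivity)]
  refine ENNReal.ofReal_le_ofReal ?_
  have : 1 ≤ √Real.pi := by
    rw [Real.one_le_sqrt]; linarith [Real.pi_gt_three]
  have h3 : 2 / √Real.pi ≤ 2 := by
    rw [div_le_iff₀ (by positivity)]; linarith
  calc 2 / √Real.pi * (1 / |s|) ≤ 2 * (1 / |s|) := by gcongr
    _ = 2 / |s| := by ring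


section Existence
variable {E : Type*} [NormedAddCommGroup E] [InnerProductSpace ℝ E] [FiniteDimensional ℝ E]

def mu (T : ℝ) : Measure ℝ := (volume : Measure ℝ).restrict (Ioc 0 T)

instance (T : ℝ) : IsFiniteMeasure (mu T) := by unfold mu; infer_instance

def pth (x0 : E) (w : ℝ → E) (t : ℝ) : E := x0 + ∫ s in (0:ℝ)..t, w s

def kin (T : ℝ) (w : ℝ → E) : ℝ := (1 / 2) * ∫ s in (0:ℝ)..T, ‖w s‖ ^ 2

def act (V : E → ℝ≥0∞) (x0 : E) (T : ℝ) (w : ℝ → E) : ℝ≥0∞ :=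
  ENNReal.ofReal (kin T w) + ∫⁻ t in Ioc 0 T, V (pth x0 w t)

lemma kin_nonneg {T : ℝ} (hT : 0 ≤ T) (w : ℝ → E) : 0 ≤ kin T w := by
  unfold kin
  have := intervalIntegral.integral_nonneg hT (f := fun s => ‖w s‖ ^ 2) (μ := volume)
    (fun s _ => by positivity)
  linarith

lemma kin_congr {T : ℝ} (hT : 0 ≤ T) {w w' : ℝ → E} (hw : w =ᵐ[mu T] w') :
    kin T w = kin T w' := by
  unfold kin
  rw [intervalIntegral.integral_of_le hT, intervalIntegral.integral_of_le hT]
  congr 1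
  refine integral_congr_ae ?_
  filter_upwards [hw] with s hs
  rw [hs]

lemma pth_congr {T t : ℝ} (x0 : E) (ht : t ∈ Icc 0 T) {w w' : ℝ → E} (hw : w =ᵐ[mu T] w') :
    pth x0 w t = pth x0 w' t := by
  unfold pth
  rw [intervalIntegral.integral_of_le ht.1, intervalIntegral.integral_of_le ht.1]
  congr 1
  refine integral_congr_ae ?_
  exact ae_mono (Measure.restrict_mono (Ioc_subset_Ioc_right ht.2) le_rfl) hw

lemma act_congr (V : E → ℝ≥0∞) (x0 : E) {T : ℝ} (hT : 0 ≤ T) {w w' : ℝ → E}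
    (hw : w =ᵐ[mu T] w') : act V x0 T w = act V x0 T w' := by
  unfold act
  rw [kin_congr hT hw]
  congr 1
  refine setLIntegral_congr_fun measurableSet_Ioc fun t ht => ?_
  rw [pth_congr x0 ⟨ht.1.le, ht.2⟩ hw]

lemma kin_Lp {T : ℝ} (hT : 0 ≤ T) (w : Lp E 2 (mu T)) : kin T w = (1 / 2) * ‖w‖ ^ 2 := by
  unfold kin
  rw [← real_inner_self_eq_norm_sq, L2.inner_def, intervalIntegral.integral_of_le hT]
  congr 1
  refine integral_congr_ae (Eventually.of_forall fun s => ?_)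
  simp

lemma weak_pth {T t : ℝ} (x0 : E) (ht : t ∈ Icc 0 T) (w : ℕ → Lp E 2 (mu T)) (w' : Lp E 2 (mu T))
    (h : ∀ y, Tendsto (fun n => ⟪w n, y⟫) atTop (𝓝 ⟪w', y⟫)) :
    Tendsto (fun n => pth x0 (w n) t) atTop (𝓝 (pth x0 w' t)) := by
  unfold pth
  refine tendsto_const_nhds.add ?_
  have key : ∀ (e : E) (f : Lp E 2 (mu T)),
      ⟪f, indicatorConstLp 2 (μ := mu T) (measurableSet_Ioc (a := 0) (b := t)) (by finiteness) e⟫ =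
        ⟪e, ∫ s in (0:ℝ)..t, f s⟫ := by
    intro e f
    rw [real_inner_comm, L2.inner_indicatorConstLp_eq_inner_setIntegral]
    have hr : (mu T).restrict (Ioc 0 t) = volume.restrict (Ioc 0 t) := by
      unfold mu
      rw [Measure.restrict_restrict measurableSet_Ioc,
        inter_eq_left.mpr (Ioc_subset_Ioc_right ht.2)]
    rw [intervalIntegral.integral_of_le ht.1, hr]
  have h2 : ∀ e : E, Tendsto (fun n => ⟪e, ∫ s in (0:ℝ)..t, w n s⟫) atTop
      (𝓝 ⟪e, ∫ s in (0:ℝ)..t, w' s⟫) := by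
    intro e
    simp_rw [← key]
    exact h _
  let b := stdOrthonormalBasis ℝ E
  have h3 : ∀ x : E, ∑ i, ⟪b i, x⟫ • b i = x := fun x => b.sum_repr' x
  rw [← h3 (∫ s in (0:ℝ)..t, w' s)]
  have h4 : (fun n => ∫ s in (0:ℝ)..t, w n s) =
      fun n => ∑ i, ⟪b i, ∫ s in (0:ℝ)..t, w n s⟫ • b i := by
    funext n; exact (h3 _).symm
  rw [h4]
  exact tendsto_finsetSum _ fun i _ => (h2 (b i)).smul_const _

lemma exists_weak {H : Type*} [NormedAddCommGroup H] [InnerProductSpace ℝ H] [CompleteSpace H]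
    [TopologicalSpace.SeparableSpace H] (w : ℕ → H) (R : ℝ) (hw : ∀ n, ‖w n‖ ≤ R) :
    ∃ w' : H, ∃ φ : ℕ → ℕ, StrictMono φ ∧
      ∀ y, Tendsto (fun n => ⟪w (φ n), y⟫) atTop (𝓝 ⟪w', y⟫) := by
  have h := WeakDual.isSeqCompact_closedBall ℝ H (0 : StrongDual ℝ H) R
  obtain ⟨a, ha, φ, hφ, hlim⟩ := h (x := fun n => StrongDual.toWeakDual (InnerProductSpace.toDual ℝ H (w n)))
    (by intro n; simpa using hw n)
  refine ⟨(InnerProductSpace.toDual ℝ H).symm (WeakDual.toStrongDual a), φ, hφ, fun y => ?_⟩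
  have := (WeakDual.eval_continuous (𝕜 := ℝ) y).continuousAt.tendsto.comp hlim
  rw [InnerProductSpace.toDual_symm_apply]
  exact this

theorem exists_min (V : E → ℝ≥0∞) (hV : Continuous V) (x0 : E) (T : ℝ) (hT : 0 ≤ T)
    (w0 : ℝ → E) (hw0 : MemLp w0 2 (mu T)) (hfin : act V x0 T w0 ≠ ∞) :
    ∃ w : ℝ → E, MemLp w 2 (mu T) ∧ ∀ w', MemLp w' 2 (mu T) → act V x0 T w ≤ act V x0 T w' := by
  have hcont : ∀ w : Lp E 2 (mu T), ContinuousOn (pth x0 w) (Icc 0 T) := by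
    intro w
    have hI : IntegrableOn (w : ℝ → E) (Icc 0 T) := by
      rw [integrableOn_Icc_iff_integrableOn_Ioc]
      exact (Lp.memLp w).integrable (by norm_num)
    exact continuousOn_const.add (intervalIntegral.continuousOn_primitive_interval
      (by rwa [uIcc_of_le hT]) |>.mono (by rw [uIcc_of_le hT]))
  obtain ⟨u, -, hu, hmem⟩ := exists_seq_tendsto_sInf (S := range fun w : Lp E 2 (mu T) => act V x0 T w)
    (range_nonempty _) (OrderBot.bddBelow _)
  set I := sInf (range fun w : Lp E 2 (mu T) => act V x0 T w) with hI
  have hle : ∀ w', MemLp w' 2 (mu T) → I ≤ act V x0 T w' := by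
    intro w' hw'
    rw [act_congr V x0 hT hw'.coeFn_toLp.symm]
    exact sInf_le ⟨_, rfl⟩
  have hIfin : I ≠ ∞ := ne_top_of_le_ne_top hfin (hle w0 hw0)
  choose w hw using hmem
  have hev : ∀ᶠ n in atTop, u n ≤ I + 1 := by
    have : I < I + 1 := ENNReal.lt_add_right hIfin one_ne_zero
    exact (hu.eventually_lt_const this).mono fun n hn => hn.le
  obtain ⟨n0, hn0⟩ := eventually_atTop.mp hev
  have hkin : ∀ n, (1 / 2) * ‖w (n + n0)‖ ^ 2 ≤ (I + 1).toReal := by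
    intro n
    have h1 := hn0 (n + n0) (by omega)
    have h2 : ENNReal.ofReal (kin T (w (n + n0))) ≤ I + 1 :=
      le_self_add.trans ((hw (n + n0)).trans_le h1)
    rw [kin_Lp hT] at h2
    rwa [ENNReal.ofReal_le_iff_le_toReal (by finiteness)] at h2
  have hbd : ∀ n, ‖w (n + n0)‖ ≤ √(2 * (I + 1).toReal) := by
    intro n
    refine Real.le_sqrt_of_sq_le ?_
    linarith [hkin n]
  have : TopologicalSpace.SeparableSpace (Lp E 2 (mu T)) := by
    have : Fact ((2:ℝ≥0∞) ≠ ∞) := ⟨by simp⟩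
    have : IsSeparable (mu T) := by unfold mu; infer_instance
    infer_instance
  obtain ⟨w', φ, hφ, hweak⟩ := exists_weak (fun n => w (n + n0)) _ hbd
  refine ⟨w', Lp.memLp w', fun w'' hw'' => le_trans ?_ (hle w'' hw'')⟩
  have hc : IsCompact (Icc (0:ℝ) (√(2 * (I + 1).toReal))) := isCompact_Icc
  obtain ⟨l, -, ψ, hψ, hl⟩ := hc.tendsto_subseq (x := fun n => ‖w (φ n + n0)‖)
    (fun n => ⟨norm_nonneg _, hbd _⟩)
  have hl0 : 0 ≤ l := ge_of_tendsto' hl fun n => norm_nonneg _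
  have hnorm : ‖w'‖ ≤ l := by
    have h1 := (hweak w').comp hψ.tendsto_atTop
    have h2 : ⟪w', w'⟫ ≤ l * ‖w'‖ := le_of_tendsto_of_tendsto' h1 (hl.mul_const ‖w'‖)
      fun n => real_inner_le_norm _ _
    rw [real_inner_self_eq_norm_sq] at h2
    by_contra hcon
    push Not at hcon
    nlinarith
  have hV1 : ∀ t ∈ Ioc 0 T, Tendsto (fun n => V (pth x0 (w (φ (ψ n) + n0)) t)) atTop
      (𝓝 (V (pth x0 w' t))) := by
    intro t ht
    have := weak_pth x0 ⟨ht.1.le, ht.2⟩ _ w' (fun y => (hweak y).comp hψ.tendsto_atTop)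
    exact (hV.tendsto _).comp this
  have hFatou : ∫⁻ t in Ioc 0 T, V (pth x0 w' t) ≤
      liminf (fun n => ∫⁻ t in Ioc 0 T, V (pth x0 (w (φ (ψ n) + n0)) t)) atTop := by
    calc _ = ∫⁻ t in Ioc 0 T, liminf (fun n => V (pth x0 (w (φ (ψ n) + n0)) t)) atTop :=
          setLIntegral_congr_fun measurableSet_Ioc fun t ht => (hV1 t ht).liminf_eq.symm
      _ ≤ _ := lintegral_liminf_le' fun n => by
          have : ContinuousOn (fun t => V (pth x0 (w (φ (ψ n) + n0)) t)) (Ioc 0 T) :=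
            hV.comp_continuousOn ((hcont _).mono Ioc_subset_Icc_self)
          exact this.aemeasurable measurableSet_Ioc
  have hK : Tendsto (fun n => ENNReal.ofReal (kin T (w (φ (ψ n) + n0)))) atTop
      (𝓝 (ENNReal.ofReal ((1 / 2) * l ^ 2))) := by
    simp_rw [kin_Lp hT]
    exact ENNReal.tendsto_ofReal ((hl.pow 2).const_mul _)
  have hsum : Tendsto (fun n => act V x0 T (w (φ (ψ n) + n0))) atTop (𝓝 I) := by
    simp_rw [hw]
    refine hu.comp ?_
    refine (tendsto_add_atTop_nat n0).comp (hφ.tendsto_atTop.comp hψ.tendsto_atTop)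
  have hb : Tendsto (fun n => ∫⁻ t in Ioc 0 T, V (pth x0 (w (φ (ψ n) + n0)) t)) atTop
      (𝓝 (I - ENNReal.ofReal ((1 / 2) * l ^ 2))) := by
    have h1 := ENNReal.Tendsto.sub hsum hK (Or.inr ENNReal.ofReal_ne_top)
    refine h1.congr fun n => ?_
    unfold act
    exact ENNReal.add_sub_cancel_left ENNReal.ofReal_ne_top
  have hLI : ENNReal.ofReal ((1 / 2) * l ^ 2) ≤ I :=
    le_of_tendsto_of_tendsto' hK hsum fun n => le_self_add
  calc act V x0 T w' ≤ ENNReal.ofReal ((1 / 2) * l ^ 2) +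
        liminf (fun n => ∫⁻ t in Ioc 0 T, V (pth x0 (w (φ (ψ n) + n0)) t)) atTop := by
        unfold act
        rw [kin_Lp hT]
        gcongr
    _ = I := by
        rw [hb.liminf_eq, add_tsub_cancel_of_le hLI]

end Existence

section Path
variable {E : Type*} [NormedAddCommGroup E] [InnerProductSpace ℝ E] [FiniteDimensional ℝ E]

theorem exists_min' (V : E → ℝ≥0∞) (hV : Continuous V) (x0 : E) (T : ℝ) (hT : 0 ≤ T)
    (w0 : ℝ → E) (hw0 : MemLp w0 2 (mu T)) (hfin : act V x0 T w0 ≠ ∞) :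
    ∃ w : ℝ → E, MemLp w 2 (mu T) ∧ Integrable w ∧
      ∀ w', MemLp w' 2 (mu T) → act V x0 T w ≤ act V x0 T w' := by
  obtain ⟨w, hw, hmin⟩ := exists_min V hV x0 T hT w0 hw0 hfin
  have he : w =ᵐ[mu T] (Ioc 0 T).indicator w := by
    filter_upwards [ae_restrict_mem measurableSet_Ioc] with s hs
    rw [indicator_of_mem hs]
  refine ⟨(Ioc 0 T).indicator w, (memLp_congr_ae he).mp hw, ?_, fun w' hw' => ?_⟩
  · rw [integrable_indicator_iff measurableSet_Ioc]
    exact hw.integrable (by norm_num)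
  · rw [← act_congr V x0 hT he]
    exact hmin w' hw'

lemma pth_zero (x0 : E) (w : ℝ → E) : pth x0 w 0 = x0 := by simp [pth]

lemma pth_cont (x0 : E) {w : ℝ → E} (hw : Integrable w) : Continuous (pth x0 w) :=
  continuous_const.add (intervalIntegral.continuous_primitive
    (fun a b => hw.intervalIntegrable) 0)

lemma MemLp.ii {T : ℝ} {w : ℝ → E} (hw : MemLp w 2 (mu T)) {s t : ℝ} (hs : s ∈ Icc 0 T)
    (ht : t ∈ Icc 0 T) : IntervalIntegrable w volume s t := by
  have hI : IntegrableOn w (Icc 0 T) := by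
    rw [integrableOn_Icc_iff_integrableOn_Ioc]
    exact hw.integrable (by norm_num)
  exact (hI.mono_set (uIcc_subset_Icc hs ht)).intervalIntegrable

lemma MemLp.iisq {T : ℝ} {w : ℝ → E} (hw : MemLp w 2 (mu T)) {s t : ℝ} (hs : s ∈ Icc 0 T)
    (ht : t ∈ Icc 0 T) : IntervalIntegrable (fun s => ‖w s‖ ^ 2) volume s t := by
  have hI : IntegrableOn (fun s => ‖w s‖ ^ 2) (Icc 0 T) := by
    rw [integrableOn_Icc_iff_integrableOn_Ioc]
    exact hw.integrable_norm_pow (by norm_num)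
  exact (hI.mono_set (uIcc_subset_Icc hs ht)).intervalIntegrable

lemma pth_add (x0 : E) {T : ℝ} {w ψ : ℝ → E} (hw : MemLp w 2 (mu T)) (hψ : MemLp ψ 2 (mu T))
    {t : ℝ} (ht : t ∈ Icc 0 T) :
    pth x0 (w + ψ) t = pth x0 w t + ∫ s in (0:ℝ)..t, ψ s := by
  have h0 : (0:ℝ) ∈ Icc 0 T := ⟨le_rfl, ht.1.trans ht.2⟩
  unfold pth
  simp only [Pi.add_apply]
  rw [intervalIntegral.integral_add (MemLp.ii hw h0 ht) (MemLp.ii hψ h0 ht), add_assoc]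

lemma int_norm_le {T : ℝ} {w : ℝ → E} (hw : MemLp w 2 (mu T)) {s t : ℝ} (hs : 0 ≤ s)
    (hst : s ≤ t) (ht : t ≤ T) :
    ∫ r in s..t, ‖w r‖ ≤ √(t - s) * (1 / 2 + kin T w) := by
  have hs' : s ∈ Icc 0 T := ⟨hs, hst.trans ht⟩
  have ht' : t ∈ Icc 0 T := ⟨hs.trans hst, ht⟩
  have h0 : (0:ℝ) ∈ Icc 0 T := ⟨le_rfl, ht'.1.trans ht⟩
  have hT' : T ∈ Icc 0 T := ⟨h0.2, le_rfl⟩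
  rcases hst.eq_or_lt with rfl | hlt
  · simp
  set l := √(t - s) with hl
  have hl0 : 0 < l := Real.sqrt_pos.mpr (by linarith)
  have hl2 : l ^ 2 = t - s := Real.sq_sqrt (by linarith)
  have h1 : ∫ r in s..t, ‖w r‖ ≤ ∫ r in s..t, (1 / (2 * l) + (l / 2) * ‖w r‖ ^ 2) := by
    refine intervalIntegral.integral_mono_on hst (MemLp.ii hw hs' ht').norm
      (intervalIntegrable_const.add ((MemLp.iisq hw hs' ht').const_mul _)) fun r _ => ?_
    have : 0 ≤ (1 - l * ‖w r‖) ^ 2 / (2 * l) := by positivity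
    have e : (1 - l * ‖w r‖) ^ 2 / (2 * l) = 1 / (2 * l) + (l / 2) * ‖w r‖ ^ 2 - ‖w r‖ := by
      field_simp; ring
    linarith
  rw [intervalIntegral.integral_add intervalIntegrable_const
    ((MemLp.iisq hw hs' ht').const_mul _), intervalIntegral.integral_const,
    intervalIntegral.integral_const_mul] at h1
  have h2 : ∫ r in s..t, ‖w r‖ ^ 2 ≤ 2 * kin T w := by
    unfold kin
    have := intervalIntegral.integral_mono_interval (μ := volume) hs hst ht (f := fun r => ‖w r‖ ^ 2)
      (Eventually.of_forall fun r => by positivity) (MemLp.iisq hw h0 hT')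
    linarith
  refine h1.trans ?_
  rw [← hl2, smul_eq_mul]
  have : l ^ 2 * (1 / (2 * l)) = l / 2 := by field_simp
  rw [this]
  nlinarith

lemma pth_holder (x0 : E) {T : ℝ} {w : ℝ → E} (hw : MemLp w 2 (mu T)) {s t : ℝ}
    (hs : s ∈ Icc 0 T) (ht : t ∈ Icc 0 T) :
    ‖pth x0 w t - pth x0 w s‖ ≤ √|t - s| * (1 / 2 + kin T w) := by
  wlog hst : s ≤ t generalizing s t
  · rw [norm_sub_rev, abs_sub_comm]
    exact this ht hs (by linarith)
  have h0 : (0:ℝ) ∈ Icc 0 T := ⟨le_rfl, ht.1.trans ht.2⟩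
  have : pth x0 w t - pth x0 w s = ∫ r in s..t, w r := by
    unfold pth
    rw [add_sub_add_left_eq_sub, intervalIntegral.integral_interval_sub_left
      (MemLp.ii hw h0 ht) (MemLp.ii hw h0 hs)]
  rw [this, abs_of_nonneg (by linarith)]
  exact (intervalIntegral.norm_integral_le_integral_norm hst).trans
    (int_norm_le hw hs.1 hst ht.2)

lemma kin_add {T : ℝ} (hT : 0 ≤ T) {w ψ : ℝ → E} (hw : MemLp w 2 (mu T)) (hψ : MemLp ψ 2 (mu T)) :
    kin T (w + ψ) = kin T w + (∫ s in (0:ℝ)..T, ⟪w s, ψ s⟫) + kin T ψ := by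
  have h0 : (0:ℝ) ∈ Icc 0 T := ⟨le_rfl, hT⟩
  have hT' : T ∈ Icc 0 T := ⟨hT, le_rfl⟩
  have hi : IntervalIntegrable (fun s => ⟪w s, ψ s⟫) volume 0 T := by
    rw [intervalIntegrable_iff_integrableOn_Ioc_of_le hT]
    have h1 := L2.integrable_inner (𝕜 := ℝ) (hw.toLp w) (hψ.toLp ψ)
    refine (integrable_congr ?_).mp h1
    filter_upwards [hw.coeFn_toLp, hψ.coeFn_toLp] with s h1 h2
    rw [h1, h2]
  unfold kin
  have e : ∀ s, ‖(w + ψ) s‖ ^ 2 = (‖w s‖ ^ 2 + 2 * ⟪w s, ψ s⟫) + ‖ψ s‖ ^ 2 := fun s =>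
    norm_add_sq_real _ _
  simp_rw [e]
  rw [intervalIntegral.integral_add ((MemLp.iisq hw h0 hT').add (hi.const_mul 2))
    (MemLp.iisq hψ h0 hT'), intervalIntegral.integral_add (MemLp.iisq hw h0 hT') (hi.const_mul 2),
    intervalIntegral.integral_const_mul]
  ring

end Path

section Pairs
variable {E : Type*} [NormedAddCommGroup E] [InnerProductSpace ℝ E] [FiniteDimensional ℝ E]
variable {ι : Type*} [Fintype ι] (c : ι → ℝ) (L : ι → E →L[ℝ] P3)

def UE (x : E) : ℝ≥0∞ := ∑ i, ENNReal.ofReal (c i) * ‖L i x‖ₑ⁻¹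
def UR (x : E) : ℝ := ∑ i, c i * ‖L i x‖⁻¹
def CF (x : E) : Prop := ∀ i, L i x ≠ 0
def FF (x : E) : E := - ∑ i, (c i / ‖L i x‖ ^ 3) • (ContinuousLinearMap.adjoint (L i)) (L i x)
def VV (h : ℝ) (x : E) : ℝ≥0∞ := UE c L x - ENNReal.ofReal h

variable {c L}

lemma UE_cont : Continuous (UE c L) := by
  unfold UE
  refine continuous_finsetSum _ fun i _ => ?_
  refine (ENNReal.continuous_const_mul ENNReal.ofReal_ne_top).comp ?_
  exact continuous_inv.comp (continuous_enorm.comp (L i).continuous)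

lemma VV_cont (h : ℝ) : Continuous (VV c L h) := by
  unfold VV
  exact (ENNReal.continuous_sub_right _).comp UE_cont

lemma UE_eq (hc : ∀ i, 0 < c i) {x : E} (hx : CF L x) : UE c L x = ENNReal.ofReal (UR c L x) := by
  unfold UE UR
  rw [ENNReal.ofReal_sum_of_nonneg fun i _ => mul_nonneg (hc i).le (by positivity)]
  refine Finset.sum_congr rfl fun i _ => ?_
  rw [ENNReal.ofReal_mul (hc i).le, ENNReal.ofReal_inv_of_pos (norm_pos_iff.mpr (hx i)),
    ofReal_norm]

lemma UR_nonneg (hc : ∀ i, 0 < c i) (x : E) : 0 ≤ UR c L x :=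
  Finset.sum_nonneg fun i _ => mul_nonneg (hc i).le (by positivity)

lemma VV_eq (hc : ∀ i, 0 < c i) {h : ℝ} (hh : 0 < h) {x : E} (hx : CF L x) :
    VV c L h x = ENNReal.ofReal (UR c L x - h) := by
  unfold VV
  rw [UE_eq hc hx, ENNReal.ofReal_sub _ hh.le]

lemma CF_open : IsOpen {x : E | CF L x} := by
  have : {x : E | CF L x} = ⋂ i, {x | L i x ≠ 0} := by ext; simp [CF]
  rw [this]
  exact isOpen_iInter_of_finite fun i => isOpen_ne_fun (L i).continuous continuous_const

lemma UE_smul {l : ℝ} (hl : 0 < l) (x : E) : UE c L (l • x) = (ENNReal.ofReal l)⁻¹ * UE c L x := by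
  unfold UE
  rw [Finset.mul_sum]
  refine Finset.sum_congr rfl fun i _ => ?_
  rw [map_smul, enorm_smul, ENNReal.mul_inv (Or.inr (by simp)) (Or.inl (by simp)),
    ← Real.enorm_of_nonneg hl.le]
  ring

lemma UR_smul {l : ℝ} (hl : 0 < l) (x : E) : UR c L (l • x) = UR c L x / l := by
  unfold UR
  rw [Finset.sum_div]
  refine Finset.sum_congr rfl fun i _ => ?_
  rw [map_smul, norm_smul, Real.norm_of_nonneg hl.le]
  field_simp

lemma UR_hasFDerivAt {x : E} (hx : CF L x) :
    HasFDerivAt (UR c L) (innerSL ℝ (FF c L x)) x := by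
  have h1 : ∀ i ∈ (Finset.univ : Finset ι), HasFDerivAt (fun x => c i * ‖L i x‖⁻¹)
      (innerSL ℝ (-((c i / ‖L i x‖ ^ 3) • (ContinuousLinearMap.adjoint (L i)) (L i x)))) x := by
    intro i _
    have hn : ‖L i x‖ ≠ 0 := norm_ne_zero_iff.mpr (hx i)
    have h2 : HasFDerivAt (fun x => ‖L i x‖ ^ 2) _ x := ((L i).hasFDerivAt (x := x)).norm_sq
    have h3 := (h2.sqrt (by positivity))
    have h4 := ((hasDerivAt_inv (by positivity)).comp_hasFDerivAt x h3).const_mul (c i)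
    have e : (fun x => c i * ‖L i x‖⁻¹) = fun y => c i * ((fun y => y⁻¹) ∘ fun x => √(‖L i x‖ ^ 2)) y := by
      funext y
      simp [Real.sqrt_sq (norm_nonneg _)]
    rw [e]
    refine h4.congr_fderiv ?_
    ext y
    simp [Real.sqrt_sq (norm_nonneg _), ContinuousLinearMap.adjoint_inner_left, real_inner_smul_left,
      inner_neg_left]
    field_simp
  have h5 := HasFDerivAt.fun_sum h1
  refine h5.congr_fderiv ?_
  ext y
  simp [FF, sum_inner, inner_neg_left, ContinuousLinearMap.sum_apply]

lemma FF_contDiffAt {x : E} (hx : CF L x) : ContDiffAt ℝ 1 (FF c L) x := by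
  unfold FF
  refine ContDiffAt.neg (ContDiffAt.sum fun i _ => ?_)
  refine ContDiffAt.smul ?_ (by fun_prop)
  refine contDiffAt_const.div ?_ (pow_ne_zero _ (norm_ne_zero_iff.mpr (hx i)))
  refine ContDiffAt.pow ?_ 3
  exact ContDiffAt.norm ℝ (by fun_prop) (hx i)

end Pairs

section Marchal
variable {E : Type*} [NormedAddCommGroup E] [InnerProductSpace ℝ E] [FiniteDimensional ℝ E]
variable {ι : Type*} [Fintype ι] {c : ι → ℝ} {L : ι → E →L[ℝ] P3}

def M2 : ℝ≥0∞ := ∫⁻ ξ, ENNReal.ofReal (‖ξ‖ ^ 2) ∂gam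

lemma UE_avg (j : P3 →L[ℝ] E) (s : ι → ℝ) (hj : ∀ k z, L k (j z) = s k • z) (x : E) (a : ℝ) :
    ∫⁻ ξ, UE c L (x + a • j ξ) ∂gam =
      ∑ k, ENNReal.ofReal (c k) * ∫⁻ ξ, ‖L k x + (a * s k) • ξ‖ₑ⁻¹ ∂gam := by
  unfold UE
  have e : ∀ k ξ, L k (x + a • j ξ) = L k x + (a * s k) • ξ := by
    intro k ξ
    rw [map_add, map_smul, hj, smul_smul]
  simp_rw [e]
  rw [lintegral_finsetSum _ (fun k _ => by fun_prop)]
  refine Finset.sum_congr rfl fun k _ => ?_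
  rw [lintegral_const_mul _ (by fun_prop)]

lemma UE_avg_le (j : P3 →L[ℝ] E) (s : ι → ℝ) (hj : ∀ k z, L k (j z) = s k • z) (x : E) (a : ℝ) :
    ∫⁻ ξ, UE c L (x + a • j ξ) ∂gam ≤ UE c L x := by
  rw [UE_avg j s hj]
  unfold UE
  gcongr with k
  exact kernel_le_inv _ _

lemma UE_avg_gain (hc : ∀ i, 0 < c i) (j : P3 →L[ℝ] E) (s : ι → ℝ)
    (hj : ∀ k z, L k (j z) = s k • z) (x : E) (a : ℝ) (i : ι) (ha : a * s i ≠ 0)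
    (hx : ‖L i x‖ ≤ |a * s i| / 4) :
    ∫⁻ ξ, UE c L (x + a • j ξ) ∂gam + ENNReal.ofReal (c i * (2 / |a * s i|)) ≤ UE c L x := by
  classical
  rw [UE_avg j s hj]
  unfold UE
  rw [← Finset.sum_erase_add _ _ (Finset.mem_univ i),
    ← Finset.sum_erase_add _ (fun i => ENNReal.ofReal (c i) * ‖L i x‖ₑ⁻¹) (Finset.mem_univ i), add_assoc]
  have hp : 0 < |a * s i| := abs_pos.mpr ha
  gcongr with k
  · exact kernel_le_inv _ _
  · rw [ENNReal.ofReal_mul (hc i).le, ← mul_add]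
    gcongr
    refine (add_le_add_left (kernel_le_scale _ _ ha) _).trans ?_
    rw [← ENNReal.ofReal_add (by positivity) (by positivity)]
    rw [ENNReal.le_inv_iff_le_inv, ← ofReal_norm, ← ENNReal.ofReal_inv_of_pos (by positivity)]
    refine ENNReal.ofReal_le_ofReal (hx.trans (le_of_eq ?_))
    field_simp
    norm_num

lemma VV_avg (hc : ∀ i, 0 < c i) {h : ℝ} (hh : 0 < h) (j : P3 →L[ℝ] E) (s : ι → ℝ)
    (hj : ∀ k z, L k (j z) = s k • z) (x : E) (a ρ : ℝ) (haρ : |a| ≤ ρ) (i : ι)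
    (hx : ‖L i x‖ ≤ c i / (2 * h)) (g : ℝ≥0∞)
    (hg : ∫⁻ ξ, UE c L (x + a • j ξ) ∂gam + g ≤ UE c L x) :
    ∫⁻ ξ, VV c L h (x + a • j ξ) ∂gam + g ≤ VV c L h x +
      ENNReal.ofReal (h * (ρ * |s i| / (c i / (2 * h))) ^ 2) * M2 := by
  set H := ENNReal.ofReal h with hH
  have hHtop : H ≠ ∞ := ENNReal.ofReal_ne_top
  have hci := hc i
  have hUE : ∀ y : E, ‖L i y‖ ≤ c i / h → H ≤ UE c L y := by
    intro y hy
    have h1 : ENNReal.ofReal (c i) * ‖L i y‖ₑ⁻¹ ≤ UE c L y :=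
      Finset.single_le_sum (f := fun i => ENNReal.ofReal (c i) * ‖L i y‖ₑ⁻¹) (fun _ _ => zero_le) (Finset.mem_univ i)
    refine le_trans ?_ h1
    have h2 : ENNReal.ofReal (h / c i) ≤ ‖L i y‖ₑ⁻¹ := by
      rw [ENNReal.le_inv_iff_le_inv, ← ofReal_norm, ← ENNReal.ofReal_inv_of_pos (by positivity)]
      refine ENNReal.ofReal_le_ofReal (hy.trans (le_of_eq ?_))
      field_simp
    calc H = ENNReal.ofReal (c i) * ENNReal.ofReal (h / c i) := by
          rw [hH, ← ENNReal.ofReal_mul hci.le]; congr 1; field_simp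
      _ ≤ _ := by gcongr
  set κ := c i / (2 * h) with hκ
  have hκ0 : 0 < κ := by positivity
  have hκ2 : c i / h = 2 * κ := by rw [hκ]; field_simp
  have hρ : 0 ≤ ρ := (abs_nonneg a).trans haρ
  have hptw : ∀ ξ : P3, VV c L h (x + a • j ξ) + H ≤ UE c L (x + a • j ξ) +
      ENNReal.ofReal (h * (ρ * |s i| / κ) ^ 2) * ENNReal.ofReal (‖ξ‖ ^ 2) := by
    intro ξ
    unfold VV
    by_cases hcase : H ≤ UE c L (x + a • j ξ)
    · rw [tsub_add_cancel_of_le hcase]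
      exact le_self_add
    · rw [tsub_eq_zero_of_le (not_le.mp hcase).le, zero_add]
      refine le_trans ?_ le_add_self
      rw [← ENNReal.ofReal_mul (by positivity)]
      refine ENNReal.ofReal_le_ofReal ?_
      have h1 : c i / h < ‖L i (x + a • j ξ)‖ := by
        by_contra hcon
        exact hcase (hUE _ (not_lt.mp hcon))
      have h2 : ‖L i (x + a • j ξ)‖ ≤ κ + ρ * |s i| * ‖ξ‖ := by
        rw [map_add, map_smul, hj, smul_smul]
        refine (norm_add_le _ _).trans (add_le_add hx ?_)
        rw [norm_smul, Real.norm_eq_abs, abs_mul]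
        gcongr
      have h3 : 1 ≤ ρ * |s i| / κ * ‖ξ‖ := by
        rw [div_mul_eq_mul_div, le_div_iff₀ hκ0]; linarith
      have h4 : 1 ≤ (ρ * |s i| / κ * ‖ξ‖) ^ 2 := one_le_pow₀ h3
      rw [mul_pow] at h4
      nlinarith
  have hIint : ∫⁻ ξ, VV c L h (x + a • j ξ) ∂gam + H ≤ ∫⁻ ξ, UE c L (x + a • j ξ) ∂gam +
      ENNReal.ofReal (h * (ρ * |s i| / κ) ^ 2) * M2 := by
    have h1 := lintegral_mono (μ := gam) hptw
    have hm1 : Measurable fun ξ : P3 => UE c L (x + a • j ξ) :=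
      (UE_cont.comp (by fun_prop : Continuous fun ξ : P3 => x + a • j ξ)).measurable
    rw [lintegral_add_right _ measurable_const, lintegral_add_left hm1,
      lintegral_const_mul _ (by fun_prop), lintegral_const, measure_univ, mul_one] at h1
    exact h1
  have hxH : VV c L h x + H = UE c L x := by
    unfold VV
    exact tsub_add_cancel_of_le (hUE x (by rw [hκ2]; linarith))
  rw [← ENNReal.add_le_add_iff_right hHtop]
  calc _ = (∫⁻ ξ, VV c L h (x + a • j ξ) ∂gam + H) + g := by ring
    _ ≤ (∫⁻ ξ, UE c L (x + a • j ξ) ∂gam + ENNReal.ofReal (h * (ρ * |s i| / κ) ^ 2) * M2) + g := by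
        gcongr
    _ = (∫⁻ ξ, UE c L (x + a • j ξ) ∂gam + g) + ENNReal.ofReal (h * (ρ * |s i| / κ) ^ 2) * M2 := by
        ring
    _ ≤ UE c L x + ENNReal.ofReal (h * (ρ * |s i| / κ) ^ 2) * M2 := by gcongr
    _ = _ := by rw [← hxH]; ring

end Marchal

section NoColl
variable {E : Type*} [NormedAddCommGroup E] [InnerProductSpace ℝ E] [FiniteDimensional ℝ E]
variable {ι : Type*} [Fintype ι] {c : ι → ℝ} {L : ι → E →L[ℝ] P3}

lemma two_min (V : E → ℝ≥0∞) (x0 : E) {T : ℝ} (hT : 0 ≤ T) {w ψ : ℝ → E} (hw : MemLp w 2 (mu T))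
    (hψ : MemLp ψ 2 (mu T))
    (hmin : ∀ w', MemLp w' 2 (mu T) → act V x0 T w ≤ act V x0 T w') :
    2 * ∫⁻ t in Ioc 0 T, V (pth x0 w t) ≤ ENNReal.ofReal (2 * kin T ψ) +
      (∫⁻ t in Ioc 0 T, V (pth x0 w t + ∫ s in (0:ℝ)..t, ψ s)) +
      (∫⁻ t in Ioc 0 T, V (pth x0 w t - ∫ s in (0:ℝ)..t, ψ s)) := by
  have h1 := hmin _ (hw.add hψ)
  have h2 := hmin _ (hw.add hψ.neg)
  have e1 : ∫⁻ t in Ioc 0 T, V (pth x0 (w + ψ) t) =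
      ∫⁻ t in Ioc 0 T, V (pth x0 w t + ∫ s in (0:ℝ)..t, ψ s) :=
    setLIntegral_congr_fun measurableSet_Ioc fun t ht => by
      simp only [pth_add x0 hw hψ ⟨ht.1.le, ht.2⟩]
  have e2 : ∫⁻ t in Ioc 0 T, V (pth x0 (w + -ψ) t) =
      ∫⁻ t in Ioc 0 T, V (pth x0 w t - ∫ s in (0:ℝ)..t, ψ s) :=
    setLIntegral_congr_fun measurableSet_Ioc fun t ht => by
      simp only [pth_add x0 hw hψ.neg ⟨ht.1.le, ht.2⟩]
      simp [sub_eq_add_neg]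
  unfold act at h1 h2
  rw [e1, kin_add hT hw hψ] at h1
  rw [e2, kin_add hT hw hψ.neg] at h2
  have e3 : kin T (-ψ) = kin T ψ := by simp [kin]
  have e4 : ∫ s in (0:ℝ)..T, ⟪w s, (-ψ) s⟫ = - ∫ s in (0:ℝ)..T, ⟪w s, ψ s⟫ := by
    simp [inner_neg_right]
  have n1 := kin_nonneg hT (w + ψ)
  have n2 := kin_nonneg hT (w + -ψ)
  rw [kin_add hT hw hψ] at n1
  rw [kin_add hT hw hψ.neg, e3, e4] at n2
  rw [e3, e4] at h2
  have n0 := kin_nonneg hT w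
  have n3 := kin_nonneg hT ψ
  have h3 := add_le_add h1 h2
  set J := ∫ s in (0:ℝ)..T, ⟪w s, ψ s⟫
  have e5 : ENNReal.ofReal (kin T w + J + kin T ψ) + ENNReal.ofReal (kin T w + -J + kin T ψ) =
      ENNReal.ofReal (kin T w) + ENNReal.ofReal (kin T w) + ENNReal.ofReal (2 * kin T ψ) := by
    rw [← ENNReal.ofReal_add n1 n2, ← ENNReal.ofReal_add n0 n0, ← ENNReal.ofReal_add (by linarith) (by linarith)]
    congr 1; ring
  rw [← ENNReal.add_le_add_iff_left (a := ENNReal.ofReal (kin T w) + ENNReal.ofReal (kin T w)) (by finiteness)]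
  rw [add_add_add_comm (ENNReal.ofReal (kin T w + J + kin T ψ)), e5] at h3
  refine le_trans (le_of_eq (by ring)) (h3.trans (le_of_eq (by ring)))

theorem no_coll (hc : ∀ i, 0 < c i) {h : ℝ} (hh : 0 < h) {x0 : E} {T : ℝ} (hT : 0 ≤ T)
    {w : ℝ → E} (hw : MemLp w 2 (mu T)) (hwi : Integrable w)
    (hmin : ∀ w', MemLp w' 2 (mu T) → act (VV c L h) x0 T w ≤ act (VV c L h) x0 T w')
    (hfin : act (VV c L h) x0 T w ≠ ∞) (i : ι) (j : P3 →L[ℝ] E) (s : ι → ℝ)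
    (hj : ∀ k z, L k (j z) = s k • z) (hsi : s i ≠ 0) {t0 : ℝ} (ht0 : t0 ∈ Ioc 0 T) :
    L i (pth x0 w t0) ≠ 0 := by
  intro hzero
  have hci := hc i
  set x := pth x0 w with hx
  have hxc : Continuous x := pth_cont x0 hwi
  have hk0 := kin_nonneg hT w
  obtain ⟨R, hR0, hR⟩ : ∃ R : ℝ, 0 < R ∧ ∀ t ∈ Icc 0 T, ‖L i (x t)‖ ≤ R * √|t - t0| := by
    refine ⟨‖L i‖ * (1 / 2 + kin T w) + 1, by positivity, fun t ht => ?_⟩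
    have h1 : L i (x t) = L i (x t - x t0) := by rw [map_sub, hzero, sub_zero]
    rw [h1]
    refine ((L i).le_opNorm _).trans ?_
    have := pth_holder x0 hw ⟨ht0.1.le, ht0.2⟩ ht
    have h2 : 0 ≤ √|t - t0| := Real.sqrt_nonneg _
    calc _ ≤ ‖L i‖ * (√|t - t0| * (1 / 2 + kin T w)) := by gcongr
      _ ≤ _ := by nlinarith
  set κ := c i / (2 * h) with hκ
  have hκ0 : 0 < κ := by positivity
  obtain ⟨δ, hδ0, hδt, hδκ⟩ : ∃ δ : ℝ, 0 < δ ∧ δ ≤ t0 ∧ R * √δ ≤ κ := by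
    refine ⟨min t0 ((κ / R) ^ 2), lt_min ht0.1 (by positivity), min_le_left _ _, ?_⟩
    calc R * √(min t0 ((κ / R) ^ 2)) ≤ R * √((κ / R) ^ 2) := by gcongr; exact min_le_right _ _
      _ = κ := by rw [Real.sqrt_sq (by positivity)]; field_simp
  let f : ContDiffBump t0 := ⟨δ / 2, δ, by positivity, by linarith⟩
  have hf0 : f 0 = 0 := f.zero_of_le_dist (by
    show δ ≤ dist 0 t0
    rw [Real.dist_eq, zero_sub, abs_neg, abs_of_pos ht0.1]; exact hδt)
  have hfC : ContDiff ℝ 1 f := f.contDiff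
  have hfc : Continuous f := hfC.continuous
  have hf' : Continuous (deriv f) := hfC.continuous_deriv le_rfl
  have hfI : ∀ t, ∫ r in (0:ℝ)..t, deriv f r = f t := by
    intro t
    rw [intervalIntegral.integral_deriv_eq_sub (fun r _ => hfC.differentiable (by norm_num) r)
      (hf'.intervalIntegrable _ _), hf0, sub_zero]
  set σ := |s i| with hσ
  have hσ0 : 0 < σ := abs_pos.mpr hsi
  set M := ∫ r in (0:ℝ)..T, (deriv f r) ^ 2 with hM
  have hM0 : 0 ≤ M := intervalIntegral.integral_nonneg hT fun r _ => by positivity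
  set m2 := M2.toReal with hm2
  have hm20 : 0 ≤ m2 := ENNReal.toReal_nonneg
  have hm2e : M2 = ENNReal.ofReal m2 := (ENNReal.ofReal_toReal gam_M2).symm
  set V := VV c L h with hV
  set Q := ∫⁻ t in Ioc 0 T, V (x t) with hQ
  have hQfin : Q ≠ ∞ := by
    intro hcon
    exact hfin (by unfold act; rw [← hx, ← hQ, hcon, add_top])
  set K := M * ‖j‖ ^ 2 * m2 + 2 * (h * (σ / κ) ^ 2 * m2) * T with hK
  have hK0 : 0 ≤ K := by positivity
  set QQ : ℝ → P3 → ℝ≥0∞ := fun a ξ => ∫⁻ t in Ioc 0 T, V (x t + (a * f t) • j ξ) with hQQ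
  -- the main inequality
  have key : ∀ ρ : ℝ, 0 < ρ → (ρ * σ / (4 * R)) ^ 2 ≤ δ / 2 →
      c i * σ / (4 * R ^ 2) * ρ ≤ K * ρ ^ 2 := by
    intro ρ hρ hη
    set η := (ρ * σ / (4 * R)) ^ 2 with hηd
    have hη0 : 0 < η := by positivity
    set S := Ioc (t0 - η) t0 with hS
    set g := ENNReal.ofReal (c i * (2 / (ρ * σ))) with hg
    set B := ENNReal.ofReal (h * (ρ * σ / κ) ^ 2) * M2 with hB
    -- pointwise
    have pw : ∀ a : ℝ, |a| = ρ → ∀ t ∈ Ioc 0 T,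
        ∫⁻ ξ, V (x t + (a * f t) • j ξ) ∂gam + S.indicator (fun _ => g) t ≤ V (x t) + B := by
      intro a ha t ht
      have haf : |a * f t| ≤ ρ := by
        rw [abs_mul, ha, abs_of_nonneg f.nonneg]
        have := f.le_one (x := t)
        nlinarith
      rcases le_or_gt δ |t - t0| with hfar | hnear
      · have hft : f t = 0 := f.zero_of_le_dist (by rw [Real.dist_eq]; exact hfar)
        have htS : t ∉ S := by
          intro htS
          have : |t - t0| ≤ η := by rw [abs_le]; constructor <;> linarith [htS.1, htS.2]
          linarith
        rw [hft, indicator_of_notMem htS]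
        simp
      · have hxκ : ‖L i (x t)‖ ≤ κ := by
          refine (hR t ⟨ht.1.le, ht.2⟩).trans (le_trans ?_ hδκ)
          gcongr
        refine VV_avg hc hh j s hj (x t) (a * f t) ρ haf i hxκ _ ?_
        by_cases htS : t ∈ S
        · have h1 : |t - t0| ≤ η := by rw [abs_le]; constructor <;> linarith [htS.1, htS.2]
          have hft : f t = 1 := f.one_of_mem_closedBall (by
            rw [Metric.mem_closedBall, Real.dist_eq]; show _ ≤ δ / 2; linarith)
          rw [indicator_of_mem htS, hft, mul_one, hg]
          have e : ρ * σ = |a * s i| := by rw [abs_mul, ha]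
          rw [e]
          refine UE_avg_gain hc j s hj (x t) a i ?_ ?_
          · rw [← abs_pos, ← e]; positivity
          · rw [← e]
            refine (hR t ⟨ht.1.le, ht.2⟩).trans ?_
            calc R * √|t - t0| ≤ R * √η := by gcongr
              _ = ρ * σ / 4 := by
                rw [hηd, Real.sqrt_sq (by positivity)]; field_simp
        · rw [indicator_of_notMem htS, add_zero]
          exact UE_avg_le j s hj _ _
    -- integrate in t
    have intd : ∀ a : ℝ, |a| = ρ →
        (∫⁻ ξ, QQ (a) ξ ∂gam) + g * ENNReal.ofReal η ≤
          Q + B * ENNReal.ofReal T := by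
      intro a ha
      have hcont : Continuous (Function.uncurry fun (ξ : P3) (t : ℝ) => V (x t + (a * f t) • j ξ)) := by
        refine (VV_cont h).comp ?_
        fun_prop
      simp only [hQQ]
      rw [lintegral_lintegral_swap hcont.measurable.aemeasurable]
      have h1 := setLIntegral_mono' (μ := volume) measurableSet_Ioc (pw a ha)
      rw [lintegral_add_right _ (measurable_const.indicator measurableSet_Ioc),
        lintegral_add_right _ measurable_const, setLIntegral_const, Real.volume_Ioc, sub_zero,
        lintegral_indicator_const measurableSet_Ioc,
        Measure.restrict_apply measurableSet_Ioc] at h1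
      refine le_trans ?_ h1
      gcongr
      have hsub : S ⊆ S ∩ Ioc 0 T := fun t ht => ⟨ht, by linarith [ht.1], ht.2.trans ht0.2⟩
      refine le_trans (le_of_eq ?_) (measure_mono hsub)
      rw [hS, Real.volume_Ioc, sub_sub_cancel]
    -- minimality
    have hmn : ∀ ξ : P3, 2 * Q ≤ ENNReal.ofReal (ρ ^ 2 * M * ‖j‖ ^ 2) * ENNReal.ofReal (‖ξ‖ ^ 2) +
        QQ ρ ξ + QQ (-ρ) ξ := by
      intro ξ
      set ψ : ℝ → E := fun r => (ρ * deriv f r) • j ξ with hψ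
      have hψc : Continuous ψ := by fun_prop
      have hψL : MemLp ψ 2 (mu T) := by
        obtain ⟨Cc, hCc⟩ := (isCompact_Icc (a := (0:ℝ)) (b := T)).exists_bound_of_continuousOn hψc.continuousOn
        refine MemLp.of_bound hψc.aestronglyMeasurable Cc ?_
        unfold mu
        refine (ae_restrict_iff' measurableSet_Ioc).mpr (Eventually.of_forall fun t ht => hCc t ⟨ht.1.le, ht.2⟩)
      have hψI : ∀ t, ∫ r in (0:ℝ)..t, ψ r = (ρ * f t) • j ξ := by
        intro t
        rw [hψ, intervalIntegral.integral_smul_const, intervalIntegral.integral_const_mul, hfI]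
      have h1 := two_min V x0 hT hw hψL hmin
      simp_rw [hψI] at h1
      refine h1.trans ?_
      gcongr ?_ + _ + ?_
      · rw [← ENNReal.ofReal_mul (by positivity)]
        refine ENNReal.ofReal_le_ofReal ?_
        unfold kin
        have e : ∀ r, ‖ψ r‖ ^ 2 = (ρ ^ 2 * ‖j ξ‖ ^ 2) * (deriv f r) ^ 2 := by
          intro r
          simp only [hψ, norm_smul, Real.norm_eq_abs, mul_pow, sq_abs]; ring
        simp_rw [e]
        rw [intervalIntegral.integral_const_mul, ← hM]
        have h2 : ‖j ξ‖ ^ 2 ≤ (‖j‖ * ‖ξ‖) ^ 2 := by gcongr; exact j.le_opNorm ξ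
        calc _ = ρ ^ 2 * M * ‖j ξ‖ ^ 2 := by ring
          _ ≤ ρ ^ 2 * M * (‖j‖ * ‖ξ‖) ^ 2 := by gcongr
          _ = _ := by ring
      · simp only [hQQ, neg_mul, neg_smul, ← sub_eq_add_neg]
        rfl
    have hmn2 : 2 * Q ≤ ENNReal.ofReal (ρ ^ 2 * M * ‖j‖ ^ 2) * M2 +
        (∫⁻ ξ, QQ (ρ) ξ ∂gam) +
        (∫⁻ ξ, QQ (-ρ) ξ ∂gam) := by
      have h1 := lintegral_mono (μ := gam) hmn
      have hmeas : ∀ a : ℝ, Measurable (QQ a) := by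
        intro a
        have hcont : Continuous (Function.uncurry fun (ξ : P3) (t : ℝ) => V (x t + (a * f t) • j ξ)) := by
          refine (VV_cont h).comp ?_
          fun_prop
        exact hcont.measurable.lintegral_prod_right
      rw [lintegral_const, measure_univ, mul_one, lintegral_add_right _ (hmeas _),
        lintegral_add_right _ (hmeas _), lintegral_const_mul _ (by fun_prop)] at h1
      exact h1
    have i1 := intd ρ (abs_of_pos hρ)
    have i2 := intd (-ρ) (by rw [abs_neg, abs_of_pos hρ])
    have fin1 : 2 * (g * ENNReal.ofReal η) ≤
        ENNReal.ofReal (ρ ^ 2 * M * ‖j‖ ^ 2) * M2 + 2 * (B * ENNReal.ofReal T) := by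
      rw [← ENNReal.add_le_add_iff_left (a := 2 * Q) (by finiteness)]
      calc _ ≤ (ENNReal.ofReal (ρ ^ 2 * M * ‖j‖ ^ 2) * M2 +
        (∫⁻ ξ, QQ (ρ) ξ ∂gam) +
        (∫⁻ ξ, QQ (-ρ) ξ ∂gam)) + 2 * (g * ENNReal.ofReal η) := by gcongr
        _ = ENNReal.ofReal (ρ ^ 2 * M * ‖j‖ ^ 2) * M2 +
          ((∫⁻ ξ, QQ (ρ) ξ ∂gam) + g * ENNReal.ofReal η) +
          ((∫⁻ ξ, QQ (-ρ) ξ ∂gam) + g * ENNReal.ofReal η) := by ring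
        _ ≤ ENNReal.ofReal (ρ ^ 2 * M * ‖j‖ ^ 2) * M2 + (Q + B * ENNReal.ofReal T) + (Q + B * ENNReal.ofReal T) := by gcongr
        _ = _ := by ring
    rw [hB, hm2e, hg, ← ENNReal.ofReal_mul (by positivity), ← ENNReal.ofReal_mul (by positivity),
      ← ENNReal.ofReal_mul (by positivity), ← ENNReal.ofReal_mul (by positivity),
      two_mul, two_mul (ENNReal.ofReal (_ * T)), ← ENNReal.ofReal_add (by positivity) (by positivity),
      ← ENNReal.ofReal_add (p := _ * T) (by positivity) (by positivity),
      ← ENNReal.ofReal_add (by positivity) (by positivity),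
      ENNReal.ofReal_le_ofReal_iff (by positivity)] at fin1
    calc _ = c i * (2 / (ρ * σ)) * η + c i * (2 / (ρ * σ)) * η := by rw [hηd]; field_simp; norm_num
      _ ≤ _ := fin1
      _ = _ := by rw [hK]; ring
  have ev1 : ∀ᶠ ρ : ℝ in 𝓝[>] 0, (ρ * σ / (4 * R)) ^ 2 < δ / 2 := by
    have : Tendsto (fun ρ : ℝ => (ρ * σ / (4 * R)) ^ 2) (𝓝[>] 0) (𝓝 ((0 * σ / (4 * R)) ^ 2)) :=
      (Continuous.tendsto (by fun_prop) 0).mono_left nhdsWithin_le_nhds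
    exact this.eventually_lt_const (by simp; positivity)
  have ev2 : ∀ᶠ ρ : ℝ in 𝓝[>] 0, K * ρ < c i * σ / (4 * R ^ 2) := by
    have : Tendsto (fun ρ : ℝ => K * ρ) (𝓝[>] 0) (𝓝 (K * 0)) :=
      (Continuous.tendsto (by fun_prop) 0).mono_left nhdsWithin_le_nhds
    exact this.eventually_lt_const (by rw [mul_zero]; positivity)
  obtain ⟨ρ, h1, h2, h3⟩ := (ev1.and (ev2.and self_mem_nhdsWithin)).exists
  have h3 : 0 < ρ := h3
  have := key ρ h3 h1.le
  nlinarith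

end NoColl

section Regularity
variable {E : Type*} [NormedAddCommGroup E] [InnerProductSpace ℝ E] [FiniteDimensional ℝ E]
variable {ι : Type*} [Fintype ι] {c : ι → ℝ} {L : ι → E →L[ℝ] P3}

lemma pth_contOn (x0 : E) {T : ℝ} (hT : 0 ≤ T) {w : ℝ → E} (hw : MemLp w 2 (mu T)) :
    ContinuousOn (pth x0 w) (Icc 0 T) := by
  unfold pth
  refine continuousOn_const.add ?_
  have h0 : (0:ℝ) ∈ Icc 0 T := ⟨le_rfl, hT⟩
  have h1 : T ∈ Icc 0 T := ⟨hT, le_rfl⟩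
  have := intervalIntegral.continuousOn_primitive_interval' (MemLp.ii hw h0 h1) (a := 0) left_mem_uIcc
  rwa [uIcc_of_le hT] at this

lemma UR_contOn : ContinuousOn (UR c L) {x | CF L x} := fun _ hx =>
  (UR_hasFDerivAt hx).continuousAt.continuousWithinAt

lemma FF_contOn : ContinuousOn (FF c L) {x | CF L x} := fun _ hx =>
  (FF_contDiffAt hx).continuousAt.continuousWithinAt

variable (c L) in
def actR (h : ℝ) (x0 : E) (T : ℝ) (w : ℝ → E) : ℝ :=
  kin T w + ∫ t in (0:ℝ)..T, max (UR c L (pth x0 w t) - h) 0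

lemma pot_contOn {h : ℝ} {x0 : E} {T : ℝ} (hT : 0 ≤ T) {w : ℝ → E} (hw : MemLp w 2 (mu T))
    (hcf : ∀ t ∈ Icc 0 T, CF L (pth x0 w t)) :
    ContinuousOn (fun t => max (UR c L (pth x0 w t) - h) 0) (Icc 0 T) :=
  ((UR_contOn.comp (pth_contOn x0 hT hw) hcf).sub continuousOn_const).sup continuousOn_const

lemma pot_ii {h : ℝ} {x0 : E} {T : ℝ} (hT : 0 ≤ T) {w : ℝ → E} (hw : MemLp w 2 (mu T))
    (hcf : ∀ t ∈ Icc 0 T, CF L (pth x0 w t)) {s t : ℝ} (hs : s ∈ Icc 0 T) (ht : t ∈ Icc 0 T) :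
    IntervalIntegrable (fun t => max (UR c L (pth x0 w t) - h) 0) volume s t :=
  ((pot_contOn hT hw hcf).mono (uIcc_subset_Icc hs ht)).intervalIntegrable

lemma act_eq (hc : ∀ i, 0 < c i) {h : ℝ} (hh : 0 < h) {x0 : E} {T : ℝ} (hT : 0 ≤ T)
    {w : ℝ → E} (hw : MemLp w 2 (mu T)) (hcf : ∀ t ∈ Icc 0 T, CF L (pth x0 w t)) :
    act (VV c L h) x0 T w = ENNReal.ofReal (actR c L h x0 T w) := by
  have h0 : (0:ℝ) ∈ Icc 0 T := ⟨le_rfl, hT⟩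
  have h1 : T ∈ Icc 0 T := ⟨hT, le_rfl⟩
  unfold act actR
  rw [ENNReal.ofReal_add (kin_nonneg hT w)
    (intervalIntegral.integral_nonneg hT fun t _ => le_max_right _ _)]
  congr 1
  rw [intervalIntegral.integral_of_le hT, ofReal_integral_eq_lintegral_ofReal
    (pot_ii hT hw hcf h0 h1).1 (Eventually.of_forall fun t => le_max_right _ _)]
  refine setLIntegral_congr_fun measurableSet_Ioc fun t ht => ?_
  rw [VV_eq hc hh (hcf t ⟨ht.1.le, ht.2⟩)]
  rcases le_total 0 (UR c L (pth x0 w t) - h) with h2 | h2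
  · rw [max_eq_left h2]
  · rw [max_eq_right h2, ENNReal.ofReal_of_nonpos h2, ENNReal.ofReal_zero]

lemma actR_nonneg {h : ℝ} {x0 : E} {T : ℝ} (hT : 0 ≤ T) (w : ℝ → E) : 0 ≤ actR c L h x0 T w :=
  add_nonneg (kin_nonneg hT w) (intervalIntegral.integral_nonneg hT fun t _ => le_max_right _ _)

lemma tube {T : ℝ} {Φ : ℝ → ℝ → E} (hΦ : Continuous (Function.uncurry Φ)) {a b : ℝ} {O : Set E}
    (hO : IsOpen O) (h0 : ∀ t ∈ Icc a b, Φ 0 t ∈ O) : ∀ᶠ ε in 𝓝 (0:ℝ), ∀ t ∈ Icc a b, Φ ε t ∈ O := by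
  refine isCompact_Icc.eventually_forall_of_forall_eventually fun t ht => ?_
  exact hΦ.continuousAt.preimage_mem_nhds (hO.mem_nhds (h0 t ht))

/-- first variation -/
lemma first_var {h : ℝ} {x0 : E} {T : ℝ} (hT : 0 ≤ T)
    {w : ℝ → E} (hw : MemLp w 2 (mu T)) (hwi : Integrable w)
    (hcf : ∀ t ∈ Icc 0 T, CF L (pth x0 w t))
    (hmin : ∀ w', MemLp w' 2 (mu T) → (∀ t ∈ Icc 0 T, CF L (pth x0 w' t)) →
      actR c L h x0 T w ≤ actR c L h x0 T w')
    {α β : ℝ} (hpos : ∀ t ∈ Icc α β, h < UR c L (pth x0 w t)) (hα : 0 ≤ α) (hβ : β ≤ T)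
    {ψ : ℝ → E} (hψ : Continuous ψ) {φ : ℝ → E} (hφ : ∀ t, φ t = ∫ s in (0:ℝ)..t, ψ s)
    (hsupp : ∀ t ∈ Icc 0 T, t ∉ Icc α β → φ t = 0) :
    (∫ t in (0:ℝ)..T, ⟪w t, ψ t⟫) + ∫ t in (0:ℝ)..T, ⟪FF c L (pth x0 w t), φ t⟫ = 0 := by
  set x := pth x0 w with hx
  have hxc : Continuous x := pth_cont x0 hwi
  have h0 : (0:ℝ) ∈ Icc 0 T := ⟨le_rfl, hT⟩
  have h1 : T ∈ Icc 0 T := ⟨hT, le_rfl⟩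
  have hφc : Continuous φ := by
    have : φ = fun t => ∫ s in (0:ℝ)..t, ψ s := funext hφ
    rw [this]
    exact intervalIntegral.continuous_primitive (fun a b => hψ.intervalIntegrable a b) 0
  have hψL : MemLp ψ 2 (mu T) := by
    obtain ⟨Cc, hCc⟩ := (isCompact_Icc (a := (0:ℝ)) (b := T)).exists_bound_of_continuousOn hψ.continuousOn
    refine MemLp.of_bound hψ.aestronglyMeasurable Cc ?_
    unfold mu
    exact (ae_restrict_iff' measurableSet_Ioc).mpr (Eventually.of_forall fun t ht => hCc t ⟨ht.1.le, ht.2⟩)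
  set Φ : ℝ → ℝ → E := fun ε t => x t + ε • φ t with hΦ
  have hΦc : Continuous (Function.uncurry Φ) := by
    simp only [hΦ]; unfold Function.uncurry; fun_prop
  have hΦ0 : ∀ t, Φ 0 t = x t := by intro t; simp [hΦ]
  obtain ⟨M, hM⟩ := (isCompact_Icc (a := (0:ℝ)) (b := T)).exists_bound_of_continuousOn
    (f := fun t => FF c L (x t)) (FF_contOn.comp hxc.continuousOn hcf)
  have hO1 : IsOpen {y : E | CF L y ∧ ‖FF c L y‖ < M + 1} := by
    have := (FF_contOn (c := c) (L := L)).norm.isOpen_inter_preimage CF_open (isOpen_Iio (a := M + 1))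
    exact this
  have hO2 : IsOpen {y : E | CF L y ∧ h < UR c L y} := by
    have := (UR_contOn (c := c) (L := L)).isOpen_inter_preimage CF_open (isOpen_Ioi (a := h))
    exact this
  have ev1 := tube (T := T) hΦc hO1 (a := 0) (b := T) (fun t ht => by
    rw [hΦ0]; exact ⟨hcf t ht, by linarith [hM t ht]⟩)
  have ev2 := tube (T := T) hΦc hO2 (a := α) (b := β) (fun t ht => by
    rw [hΦ0]; exact ⟨hcf t ⟨hα.trans ht.1, ht.2.trans hβ⟩, hpos t ht⟩)
  obtain ⟨r, hr0, hr⟩ := Metric.eventually_nhds_iff_ball.mp ev1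
  set A := ∫ t in (0:ℝ)..T, ⟪w t, ψ t⟫
  -- derivative of the potential part
  obtain ⟨Mφ, hMφ⟩ := (isCompact_Icc (a := (0:ℝ)) (b := T)).exists_bound_of_continuousOn hφc.continuousOn
  have hUc : ∀ ε ∈ Metric.ball (0:ℝ) r, ContinuousOn (fun t => UR c L (Φ ε t)) (Icc 0 T) := by
    intro ε hε
    refine UR_contOn.comp (by simp only [hΦ]; fun_prop) fun t ht => (hr ε hε t ht).1
  have hder : HasDerivAt (fun ε => ∫ t in (0:ℝ)..T, UR c L (Φ ε t))
      (∫ t in (0:ℝ)..T, ⟪FF c L (Φ 0 t), φ t⟫) 0 := by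
    refine (intervalIntegral.hasDerivAt_integral_of_dominated_loc_of_deriv_le
      (bound := fun _ => (M + 1) * Mφ) (s := Metric.ball (0:ℝ) r) (F := fun ε t => UR c L (Φ ε t))
      (F' := fun ε t => ⟪FF c L (Φ ε t), φ t⟫)
      (Metric.ball_mem_nhds 0 hr0) ?_ ?_ ?_ ?_ intervalIntegrable_const ?_).2
    · filter_upwards [Metric.ball_mem_nhds 0 hr0] with ε hε
      rw [uIoc_of_le hT]
      exact ((hUc ε hε).mono Ioc_subset_Icc_self).aestronglyMeasurable measurableSet_Ioc
    · refine ContinuousOn.intervalIntegrable ?_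
      rw [uIcc_of_le hT]
      exact hUc 0 (Metric.mem_ball_self hr0)
    · rw [uIoc_of_le hT]
      refine ContinuousOn.aestronglyMeasurable ?_ measurableSet_Ioc
      refine ContinuousOn.inner ?_ hφc.continuousOn
      refine FF_contOn.comp (by simp only [hΦ]; fun_prop) fun t ht =>
        (hr 0 (Metric.mem_ball_self hr0) t ⟨ht.1.le, ht.2⟩).1
    · refine Eventually.of_forall fun t ht ε hε => ?_
      rw [uIoc_of_le hT] at ht
      have ht' : t ∈ Icc 0 T := ⟨ht.1.le, ht.2⟩
      refine (norm_inner_le_norm _ _).trans ?_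
      exact mul_le_mul (hr ε hε t ht').2.le (hMφ t ht') (norm_nonneg _)
        ((norm_nonneg _).trans (hr ε hε t ht').2.le)
    · refine Eventually.of_forall fun t ht ε hε => ?_
      rw [uIoc_of_le hT] at ht
      have ht' : t ∈ Icc 0 T := ⟨ht.1.le, ht.2⟩
      have d1 : HasDerivAt (fun ε : ℝ => Φ ε t) (φ t) ε := by
        simpa [hΦ] using ((hasDerivAt_id ε).smul_const (φ t)).const_add (x t)
      have d2 := (UR_hasFDerivAt (c := c) (hr ε hε t ht').1).comp_hasDerivAt ε d1
      simpa [Function.comp_def] using d2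
  have hder2 : HasDerivAt (fun ε => (ε * A + ε ^ 2 * kin T ψ) + ∫ t in (0:ℝ)..T, UR c L (Φ ε t))
      (A + ∫ t in (0:ℝ)..T, ⟪FF c L (Φ 0 t), φ t⟫) 0 := by
    have d1 : HasDerivAt (fun ε : ℝ => ε * A + ε ^ 2 * kin T ψ) A 0 := by
      have := ((hasDerivAt_id (0:ℝ)).mul_const A).add (((hasDerivAt_id (0:ℝ)).pow 2).mul_const (kin T ψ))
      refine this.congr_deriv ?_
      simp
    exact d1.add hder
  have hloc : IsLocalMin (fun ε => (ε * A + ε ^ 2 * kin T ψ) + ∫ t in (0:ℝ)..T, UR c L (Φ ε t)) 0 := by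
    filter_upwards [ev1, ev2, Metric.ball_mem_nhds 0 hr0] with ε e1 e2 hε
    have hwψ : MemLp (w + ε • ψ) 2 (mu T) := hw.add (hψL.const_smul ε)
    have hp : ∀ t ∈ Icc 0 T, pth x0 (w + ε • ψ) t = Φ ε t := by
      intro t ht
      rw [pth_add x0 hw (hψL.const_smul ε) ht]
      simp [hΦ, hφ, hx]
    have hcf' : ∀ t ∈ Icc 0 T, CF L (pth x0 (w + ε • ψ) t) := by
      intro t ht; rw [hp t ht]; exact (e1 t ht).1
    have hm := hmin _ hwψ hcf'
    unfold actR at hm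
    have hk : kin T (w + ε • ψ) = kin T w + ε * A + ε ^ 2 * kin T ψ := by
      rw [kin_add hT hw (hψL.const_smul ε)]
      congr 1
      · congr 1
        simp [real_inner_smul_right, A]
      · unfold kin
        simp only [Pi.smul_apply, norm_smul, mul_pow, Real.norm_eq_abs, sq_abs]
        rw [intervalIntegral.integral_const_mul]; ring
    rw [hk] at hm
    have hdiff : (∫ t in (0:ℝ)..T, max (UR c L (pth x0 (w + ε • ψ) t) - h) 0) -
        (∫ t in (0:ℝ)..T, max (UR c L (pth x0 w t) - h) 0) =
        (∫ t in (0:ℝ)..T, UR c L (Φ ε t)) - ∫ t in (0:ℝ)..T, UR c L (Φ 0 t) := by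
      rw [← intervalIntegral.integral_sub (pot_ii hT hwψ hcf' h0 h1) (pot_ii hT hw hcf h0 h1),
        ← intervalIntegral.integral_sub]
      · refine intervalIntegral.integral_congr fun t ht => ?_
        rw [uIcc_of_le hT] at ht
        simp only [hp t ht, hΦ0]
        by_cases htαβ : t ∈ Icc α β
        · rw [max_eq_left (by linarith [(e2 t htαβ).2]), max_eq_left (by linarith [hpos t htαβ])]
          ring
        · have : Φ ε t = x t := by simp [hΦ, hsupp t ht htαβ]
          rw [this, ← hx]; ring
      · exact ContinuousOn.intervalIntegrable (by rw [uIcc_of_le hT]; exact hUc ε hε)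
      · exact ContinuousOn.intervalIntegrable (by
          rw [uIcc_of_le hT]; exact hUc 0 (Metric.mem_ball_self hr0))
    simp only [zero_mul, ne_eq, OfNat.ofNat_ne_zero, not_false_eq_true, zero_pow, zero_add]
    linarith
  have := hloc.hasDerivAt_eq_zero hder2
  simpa only [hΦ0] using this

end Regularity

section DuBois
variable {E : Type*} [NormedAddCommGroup E] [InnerProductSpace ℝ E] [FiniteDimensional ℝ E]
variable {ι : Type*} [Fintype ι] {c : ι → ℝ} {L : ι → E →L[ℝ] P3}

lemma prim_supp {T α β : ℝ} (hα : 0 ≤ α) (hβ : β ≤ T) {ψ : ℝ → ℝ} (hψ : Continuous ψ)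
    (hs : ∀ t, t ∉ Icc α β → ψ t = 0) (hI : ∫ t in (0:ℝ)..T, ψ t = 0) (t : ℝ) (ht : t ∈ Icc 0 T)
    (ht' : t ∉ Icc α β) : ∫ s in (0:ℝ)..t, ψ s = 0 := by
  rcases lt_or_ge t α with h1 | h1
  · refine (intervalIntegral.integral_congr (g := fun _ => (0:ℝ)) fun s hs' => ?_).trans (by simp)
    rw [uIcc_of_le ht.1] at hs'
    exact hs s fun h2 => by linarith [h2.1, hs'.2]
  · have h2 : β < t := by
      by_contra h3
      exact ht' ⟨h1, not_lt.mp h3⟩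
    have h3 := intervalIntegral.integral_add_adjacent_intervals (hψ.intervalIntegrable (μ := volume) 0 t)
      (hψ.intervalIntegrable t T)
    have h4 : ∫ s in t..T, ψ s = 0 := by
      refine (intervalIntegral.integral_congr (g := fun _ => (0:ℝ)) fun s hs' => ?_).trans (by simp)
      rw [uIcc_of_le ht.2] at hs'
      exact hs s fun h2 => by linarith [h2.2, hs'.1]
    rw [h4, add_zero] at h3
    rw [h3, hI]

theorem EL {h : ℝ} {x0 : E} {T : ℝ} (hT : 0 ≤ T)
    {w : ℝ → E} (hw : MemLp w 2 (mu T)) (hwi : Integrable w)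
    (hcf : ∀ t ∈ Icc 0 T, CF L (pth x0 w t))
    (hmin : ∀ w', MemLp w' 2 (mu T) → (∀ t ∈ Icc 0 T, CF L (pth x0 w' t)) →
      actR c L h x0 T w ≤ actR c L h x0 T w')
    {b : ℝ} (hb : 0 < b) (hbT : b ≤ T) (hpos : ∀ t ∈ Ioo 0 b, h < UR c L (pth x0 w t)) :
    ∃ v0 : E, ∀ᵐ t, t ∈ Ioo 0 b → w t = v0 + ∫ s in (0:ℝ)..t, FF c L (pth x0 w s) := by
  set x := pth x0 w with hx
  have hxc : Continuous x := pth_cont x0 hwi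
  have hFc : ContinuousOn (fun t => FF c L (x t)) (Icc 0 T) := FF_contOn.comp hxc.continuousOn hcf
  set F : ℝ → E := IccExtend hT (fun t : Icc 0 T => FF c L (x t)) with hF
  have hFcont : Continuous F := (continuousOn_iff_continuous_domRestrict.mp hFc).Icc_extend'
  have hFe : ∀ t ∈ Icc 0 T, F t = FF c L (x t) := fun t ht => IccExtend_of_mem hT _ ht
  set P : ℝ → E := fun t => ∫ s in (0:ℝ)..t, F s with hP
  have hPd : ∀ t, HasDerivAt P (F t) t := fun t => hFcont.integral_hasStrictDerivAt 0 t |>.hasDerivAt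
  have hPc : Continuous P := continuous_iff_continuousAt.mpr fun t => (hPd t).continuousAt
  have hPe : ∀ t ∈ Icc 0 T, P t = ∫ s in (0:ℝ)..t, FF c L (x s) := by
    intro t ht
    refine intervalIntegral.integral_congr fun s hs => ?_
    rw [uIcc_of_le ht.1] at hs
    exact hFe s ⟨hs.1, hs.2.trans ht.2⟩
  have hwP : ∀ a b : ℝ, IntervalIntegrable (fun t => w t - P t) volume a b := fun a b =>
    hwi.intervalIntegrable.sub (hPc.intervalIntegrable a b)
  -- step 1
  have step1 : ∀ (α β : ℝ) (ψ : ℝ → ℝ), 0 < α → β < b → Continuous ψ → (∀ t, t ∉ Icc α β → ψ t = 0) →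
      ∫ t in (0:ℝ)..T, ψ t = 0 → ∫ t in (0:ℝ)..T, ψ t • (w t - P t) = 0 := by
    intro α β ψ hα hβ hψ hs hI
    have hIint : IntervalIntegrable (fun t => ψ t • (w t - P t)) volume 0 T :=
      (hwP 0 T).continuousOn_smul hψ.continuousOn
    refine ext_inner_right ℝ fun e => ?_
    rw [inner_zero_left, real_inner_comm, ← innerSL_apply_apply (𝕜 := ℝ),
      ← ContinuousLinearMap.intervalIntegral_comp_comm _ hIint]
    set φ : ℝ → ℝ := fun t => ∫ s in (0:ℝ)..t, ψ s with hφ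
    have hφs : ∀ t ∈ Icc 0 T, t ∉ Icc α β → φ t = 0 := prim_supp hα.le (hβ.le.trans hbT) hψ hs hI
    have hφd : ∀ t, HasDerivAt φ (ψ t) t := fun t => hψ.integral_hasStrictDerivAt 0 t |>.hasDerivAt
    have hφc : Continuous φ := continuous_iff_continuousAt.mpr fun t => (hφd t).continuousAt
    have fv := first_var (c := c) (L := L) hT hw hwi hcf hmin (α := α) (β := β)
      (fun t ht => hpos t ⟨hα.trans_le ht.1, ht.2.trans_lt hβ⟩) hα.le (hβ.le.trans hbT)
      (ψ := fun t => ψ t • e) (by fun_prop) (φ := fun t => φ t • e)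
      (fun t => by rw [intervalIntegral.integral_smul_const])
      (fun t ht ht' => by simp only [hφs t ht ht', zero_smul])
    have ibp := intervalIntegral.integral_mul_deriv_eq_deriv_mul (a := 0) (b := T)
      (u := fun t => ⟪P t, e⟫) (v := φ) (u' := fun t => ⟪F t, e⟫) (v' := ψ)
      (fun t _ => by simpa using (hPd t).inner ℝ (hasDerivAt_const t e)) (fun t _ => hφd t)
      (Continuous.intervalIntegrable (by fun_prop) _ _) (hψ.intervalIntegrable _ _)
    have e0 : φ 0 = 0 := by simp [hφ]
    have eT : φ T = 0 := hI
    rw [e0, eT, mul_zero, mul_zero, sub_zero, zero_sub] at ibp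
    have e1 : ∫ t in (0:ℝ)..T, ⟪FF c L (pth x0 w t), φ t • e⟫ = ∫ t in (0:ℝ)..T, ⟪F t, e⟫ * φ t := by
      refine intervalIntegral.integral_congr fun t ht => ?_
      rw [uIcc_of_le hT] at ht
      simp only [hFe t ht, real_inner_smul_right, ← hx]; ring
    rw [e1] at fv
    have e2 : ∫ t in (0:ℝ)..T, (innerSL ℝ e) (ψ t • (w t - P t)) =
        (∫ t in (0:ℝ)..T, ⟪w t, ψ t • e⟫) - ∫ t in (0:ℝ)..T, ⟪P t, e⟫ * ψ t := by
      rw [← intervalIntegral.integral_sub]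
      · refine intervalIntegral.integral_congr fun t ht => ?_
        simp only [innerSL_apply_apply, real_inner_smul_right, inner_sub_right, real_inner_comm]
        ring
      · have h1 : IntervalIntegrable (fun t => (innerSL ℝ e) (w t)) volume 0 T :=
          ((innerSL ℝ e).integrable_comp hwi).intervalIntegrable
        have h2 := h1.continuousOn_mul (g := ψ) hψ.continuousOn
        refine h2.congr fun t _ => ?_
        simp only [innerSL_apply_apply, real_inner_smul_right, real_inner_comm]
      · exact Continuous.intervalIntegrable (by fun_prop) _ _
    rw [e2]
    linarith
  -- step 2
  let f : ContDiffBump (b / 2) := ⟨b / 8, b / 4, by positivity, by linarith⟩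
  set η : ℝ → ℝ := f.normed volume with hη
  have hηc : Continuous η := f.continuous_normed
  have hηt : tsupport η = Icc (b / 4) (3 * b / 4) := by
    rw [hη, f.tsupport_normed_eq, Real.closedBall_eq_Icc]
    congr 1 <;> simp only [f] <;> ring
  have hηI : ∫ t in (0:ℝ)..T, η t = 1 := by
    rw [intervalIntegral.integral_eq_integral_of_support_subset, hη, f.integral_normed]
    refine (subset_tsupport _).trans ?_
    rw [hηt]
    intro t ht
    exact ⟨by linarith [ht.1], by linarith [ht.2]⟩
  set κ := ∫ t in (0:ℝ)..T, η t • (w t - P t) with hκ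
  refine ⟨κ, ?_⟩
  have hae := isOpen_Ioo.ae_eq_zero_of_integral_contDiff_smul_eq_zero (μ := volume) (U := Ioo 0 b)
    (f := fun t => w t - P t - κ) ?_ ?_
  · filter_upwards [hae] with t ht htb
    have := ht htb
    rw [← hPe t ⟨htb.1.le, htb.2.le.trans hbT⟩]
    rw [sub_sub, sub_eq_zero] at this
    rw [this, add_comm]
  · exact LocallyIntegrable.locallyIntegrableOn ((hwi.locallyIntegrable.sub hPc.locallyIntegrable).sub
      continuous_const.locallyIntegrable) _
  · intro g hg hgc hgs
    have hgcont : Continuous g := hg.continuous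
    have hK : IsCompact (tsupport g ∪ tsupport η) :=
      hgc.isCompact.union (by rw [hηt]; exact isCompact_Icc)
    have hKn : (tsupport g ∪ tsupport η).Nonempty :=
      ⟨b / 2, Or.inr (by rw [hηt]; constructor <;> linarith)⟩
    have hKs : tsupport g ∪ tsupport η ⊆ Ioo 0 b := by
      refine union_subset hgs ?_
      rw [hηt]
      intro t ht
      exact ⟨by linarith [ht.1], by linarith [ht.2]⟩
    obtain ⟨α, hα, hαl⟩ := hK.exists_isLeast hKn
    obtain ⟨β, hβ, hβg⟩ := hK.exists_isGreatest hKn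
    have hzero : ∀ t, t ∉ Icc α β → g t = 0 ∧ η t = 0 := by
      intro t ht
      constructor
      · refine image_eq_zero_of_notMem_tsupport fun h1 => ht ⟨hαl (Or.inl h1), hβg (Or.inl h1)⟩
      · refine image_eq_zero_of_notMem_tsupport fun h1 => ht ⟨hαl (Or.inr h1), hβg (Or.inr h1)⟩
    set G := ∫ t in (0:ℝ)..T, g t with hG
    have h1 := step1 α β (fun t => g t - G * η t) (hKs hα).1 (hKs hβ).2 (by fun_prop)
      (fun t ht => by simp [hzero t ht]) (by
        rw [intervalIntegral.integral_sub (hgcont.intervalIntegrable _ _)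
          (Continuous.intervalIntegrable (by fun_prop) _ _), intervalIntegral.integral_const_mul, hηI]
        simp [hG])
    have i1 : IntervalIntegrable (fun t => g t • (w t - P t)) volume 0 T :=
      (hwP 0 T).continuousOn_smul hgcont.continuousOn
    have i2 : IntervalIntegrable (fun t => η t • (w t - P t)) volume 0 T :=
      (hwP 0 T).continuousOn_smul hηc.continuousOn
    have h2 : ∫ t in (0:ℝ)..T, (g t - G * η t) • (w t - P t) =
        (∫ t in (0:ℝ)..T, g t • (w t - P t)) - G • κ := by
      simp_rw [sub_smul, mul_smul]
      have i3 : IntervalIntegrable (fun t => G • η t • (w t - P t)) volume 0 T := i2.smul G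
      rw [intervalIntegral.integral_sub i1 i3, intervalIntegral.integral_smul]
    rw [h2] at h1
    rw [← intervalIntegral.integral_eq_integral_of_support_subset (a := 0) (b := T)]
    · simp_rw [smul_sub _ _ κ]
      rw [intervalIntegral.integral_sub i1 (Continuous.intervalIntegrable (by fun_prop) _ _),
        intervalIntegral.integral_smul_const]
      exact h1
    · intro t ht
      have : t ∈ Ioo 0 b := hgs (subset_tsupport _ (fun h3 => ht (by simp only [h3, zero_smul])))
      exact ⟨this.1, this.2.le.trans hbT⟩

end DuBois

section Minimizer
variable {E : Type*} [NormedAddCommGroup E] [InnerProductSpace ℝ E] [FiniteDimensional ℝ E]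
variable {ι : Type*} [Fintype ι] {c : ι → ℝ} {L : ι → E →L[ℝ] P3}

lemma CF_smul {l : ℝ} (hl : 0 < l) {x : E} (hx : CF L x) : CF L (l • x) := fun i => by
  rw [map_smul]
  exact smul_ne_zero hl.ne' (hx i)

lemma competitor {h : ℝ} (hh : 0 < h) {x0 : E} (hx0 : CF L x0) (hU : h ≤ UR c L x0) :
    ∃ C : ℝ, 0 ≤ C ∧ ∀ T, 1 ≤ T → ∃ w : ℝ → E, MemLp w 2 (mu T) ∧
      (∀ t ∈ Icc 0 T, CF L (pth x0 w t)) ∧ actR c L h x0 T w ≤ C := by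
  set l := UR c L x0 / h with hl
  have hl1 : 1 ≤ l := by rw [hl, le_div_iff₀ hh]; linarith
  refine ⟨(1 / 2) * ((l - 1) ^ 2 * ‖x0‖ ^ 2) + (UR c L x0 - h), by
    have : 0 ≤ UR c L x0 - h := by linarith
    positivity, fun T hT => ?_⟩
  have hT0 : 0 ≤ T := by linarith
  have h0 : (0:ℝ) ∈ Icc 0 T := ⟨le_rfl, hT0⟩
  have h1 : (1:ℝ) ∈ Icc 0 T := ⟨by norm_num, hT⟩
  have hTT : T ∈ Icc 0 T := ⟨hT0, le_rfl⟩
  set w : ℝ → E := (Ioc (0:ℝ) 1).indicator (fun _ => (l - 1) • x0) with hw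
  have hwL : MemLp w 2 (mu T) := (memLp_const _).indicator measurableSet_Ioc
  have hp1 : ∀ t ∈ Icc (0:ℝ) 1, pth x0 w t = (1 + (l - 1) * t) • x0 := by
    intro t ht
    unfold pth
    have : ∫ s in (0:ℝ)..t, w s = ∫ s in (0:ℝ)..t, (l - 1) • x0 := by
      rw [intervalIntegral.integral_of_le ht.1, intervalIntegral.integral_of_le ht.1]
      refine setIntegral_congr_fun measurableSet_Ioc fun s hs => ?_
      have hm : s ∈ Set.Ioc (0:ℝ) 1 := ⟨hs.1, hs.2.trans ht.2⟩
      exact indicator_of_mem hm _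
    rw [this, intervalIntegral.integral_const, sub_zero, add_smul, one_smul, smul_smul, mul_comm t]
  have hp2 : ∀ t ∈ Icc 1 T, pth x0 w t = l • x0 := by
    intro t ht
    have h2 := hp1 1 ⟨by norm_num, le_rfl⟩
    have ht' : t ∈ Icc 0 T := ⟨by linarith [ht.1], ht.2⟩
    unfold pth at h2 ⊢
    rw [← intervalIntegral.integral_add_adjacent_intervals (MemLp.ii hwL h0 h1) (MemLp.ii hwL h1 ht'),
      ← add_assoc, h2]
    have : ∫ s in (1:ℝ)..t, w s = 0 := by
      rw [intervalIntegral.integral_of_le ht.1]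
      refine (setIntegral_congr_fun (g := fun _ => (0:E)) measurableSet_Ioc fun s hs => ?_).trans (by simp)
      exact indicator_of_notMem (fun h3 => by linarith [h3.2, hs.1]) _
    rw [this, add_zero]; congr 1; ring
  have hcf : ∀ t ∈ Icc 0 T, CF L (pth x0 w t) := by
    intro t ht
    rcases le_total t 1 with h2 | h2
    · rw [hp1 t ⟨ht.1, h2⟩]
      have : 0 ≤ (l - 1) * t := mul_nonneg (by linarith) ht.1
      exact CF_smul (by linarith) hx0
    · rw [hp2 t ⟨h2, ht.2⟩]
      exact CF_smul (by linarith) hx0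
  refine ⟨w, hwL, hcf, ?_⟩
  unfold actR
  have hU0 : 0 < UR c L x0 := hh.trans_le hU
  gcongr
  · unfold kin
    gcongr
    rw [← intervalIntegral.integral_add_adjacent_intervals (MemLp.iisq hwL h0 h1) (MemLp.iisq hwL h1 hTT)]
    have e1 : ∫ s in (0:ℝ)..1, ‖w s‖ ^ 2 = ∫ s in (0:ℝ)..1, (l - 1) ^ 2 * ‖x0‖ ^ 2 := by
      rw [intervalIntegral.integral_of_le zero_le_one, intervalIntegral.integral_of_le zero_le_one]
      refine setIntegral_congr_fun measurableSet_Ioc fun s hs => ?_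
      simp only [hw, indicator_of_mem hs, norm_smul, mul_pow, Real.norm_eq_abs, sq_abs]
    have e2 : ∫ s in (1:ℝ)..T, ‖w s‖ ^ 2 = 0 := by
      rw [intervalIntegral.integral_of_le hT]
      refine (setIntegral_congr_fun (g := fun _ => (0:ℝ)) measurableSet_Ioc fun s hs => ?_).trans (by simp)
      have : s ∉ Ioc (0:ℝ) 1 := fun h3 => by linarith [h3.2, hs.1]
      simp only [hw, indicator_of_notMem this, norm_zero]; norm_num
    rw [e1, e2]; simp
  · rw [← intervalIntegral.integral_add_adjacent_intervals (pot_ii hT0 hwL hcf h0 h1)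
      (pot_ii hT0 hwL hcf h1 hTT)]
    have e1 : ∫ t in (0:ℝ)..1, max (UR c L (pth x0 w t) - h) 0 ≤ ∫ t in (0:ℝ)..1, (UR c L x0 - h) := by
      refine intervalIntegral.integral_mono_on zero_le_one (pot_ii hT0 hwL hcf h0 h1)
        intervalIntegrable_const fun t ht => ?_
      rw [hp1 t ht]
      have : 0 ≤ (l - 1) * t := mul_nonneg (by linarith) ht.1
      rw [UR_smul (by linarith)]
      refine max_le ?_ (by linarith)
      gcongr
      exact div_le_self hU0.le (by linarith)
    have e2 : ∫ t in (1:ℝ)..T, max (UR c L (pth x0 w t) - h) 0 = 0 := by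
      refine (intervalIntegral.integral_congr (g := fun _ => (0:ℝ)) fun t ht => ?_).trans (by simp)
      rw [uIcc_of_le hT] at ht
      simp only
      rw [hp2 t ht, UR_smul (by linarith), hl]
      have : UR c L x0 / (UR c L x0 / h) = h := by field_simp
      rw [this]; simp
    rw [e2]
    simpa using e1

theorem minimizer (hc : ∀ i, 0 < c i) {h : ℝ} (hh : 0 < h)
    (hj : ∀ i, ∃ j : P3 →L[ℝ] E, ∃ s : ι → ℝ, s i ≠ 0 ∧ ∀ k z, L k (j z) = s k • z)
    {x0 : E} (hx0 : CF L x0) (hU : h ≤ UR c L x0) :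
    ∃ C : ℝ, 0 ≤ C ∧ ∀ T, 1 ≤ T → ∃ w : ℝ → E, MemLp w 2 (mu T) ∧ Integrable w ∧
      (∀ t ∈ Icc 0 T, CF L (pth x0 w t)) ∧ actR c L h x0 T w ≤ C ∧
      (∀ w', MemLp w' 2 (mu T) → (∀ t ∈ Icc 0 T, CF L (pth x0 w' t)) →
        actR c L h x0 T w ≤ actR c L h x0 T w') := by
  obtain ⟨C, hC0, hC⟩ := competitor (c := c) hh hx0 hU
  refine ⟨C, hC0, fun T hT => ?_⟩
  have hT0 : 0 ≤ T := by linarith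
  obtain ⟨w0, hw0, hcf0, hw0C⟩ := hC T hT
  have hfin0 : act (VV c L h) x0 T w0 ≠ ∞ := by
    rw [act_eq hc hh hT0 hw0 hcf0]; exact ENNReal.ofReal_ne_top
  obtain ⟨w, hw, hwi, hmin⟩ := exists_min' (VV c L h) (VV_cont h) x0 T hT0 w0 hw0 hfin0
  have hfin : act (VV c L h) x0 T w ≠ ∞ := ne_top_of_le_ne_top hfin0 (hmin w0 hw0)
  have hcf : ∀ t ∈ Icc 0 T, CF L (pth x0 w t) := by
    intro t ht i
    rcases ht.1.eq_or_lt with h1 | h1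
    · rw [← h1, pth_zero]; exact hx0 i
    · obtain ⟨j, s, hs, hjs⟩ := hj i
      exact no_coll hc hh hT0 hw hwi hmin hfin i j s hjs hs ⟨h1, ht.2⟩
  have hminR : ∀ w', MemLp w' 2 (mu T) → (∀ t ∈ Icc 0 T, CF L (pth x0 w' t)) →
      actR c L h x0 T w ≤ actR c L h x0 T w' := by
    intro w' hw' hcf'
    have h1 := hmin w' hw'
    rw [act_eq hc hh hT0 hw hcf, act_eq hc hh hT0 hw' hcf'] at h1
    exact (ENNReal.ofReal_le_ofReal_iff (actR_nonneg hT0 _)).mp h1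
  exact ⟨w, hw, hwi, hcf, (hminR w0 hw0 hcf0).trans hw0C, hminR⟩

/-- smooth description of the minimizer up to the first exit time -/
theorem sol_on {h : ℝ} {x0 : E} {T : ℝ} (hT : 0 ≤ T)
    {w : ℝ → E} (hw : MemLp w 2 (mu T)) (hwi : Integrable w)
    (hcf : ∀ t ∈ Icc 0 T, CF L (pth x0 w t))
    (hmin : ∀ w', MemLp w' 2 (mu T) → (∀ t ∈ Icc 0 T, CF L (pth x0 w' t)) →
      actR c L h x0 T w ≤ actR c L h x0 T w')
    {b : ℝ} (hb : 0 < b) (hbT : b ≤ T) (hpos : ∀ t ∈ Ioo 0 b, h < UR c L (pth x0 w t)) :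
    ∃ y v : ℝ → E, (∀ t, HasDerivAt y (v t) t) ∧ Continuous v ∧
      (∀ t ∈ Icc 0 b, HasDerivAt v (FF c L (y t)) t) ∧ (∀ t ∈ Icc 0 b, y t = pth x0 w t) ∧
      (∀ᵐ t, t ∈ Ioo 0 b → w t = v t) := by
  obtain ⟨v0, hv0⟩ := EL hT hw hwi hcf hmin hb hbT hpos
  set x := pth x0 w with hx
  have hxc : Continuous x := pth_cont x0 hwi
  have hFc : ContinuousOn (fun t => FF c L (x t)) (Icc 0 T) := FF_contOn.comp hxc.continuousOn hcf
  set F : ℝ → E := IccExtend hT (fun t : Icc 0 T => FF c L (x t)) with hF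
  have hFcont : Continuous F := (continuousOn_iff_continuous_domRestrict.mp hFc).Icc_extend'
  have hFe : ∀ t ∈ Icc 0 T, F t = FF c L (x t) := fun t ht => IccExtend_of_mem hT _ ht
  set v : ℝ → E := fun t => v0 + ∫ s in (0:ℝ)..t, F s with hv
  have hvd : ∀ t, HasDerivAt v (F t) t := fun t =>
    (hFcont.integral_hasStrictDerivAt 0 t |>.hasDerivAt).const_add v0
  have hvc : Continuous v := continuous_iff_continuousAt.mpr fun t => (hvd t).continuousAt
  set y : ℝ → E := fun t => x0 + ∫ s in (0:ℝ)..t, v s with hy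
  have hyd : ∀ t, HasDerivAt y (v t) t := fun t =>
    (hvc.integral_hasStrictDerivAt 0 t |>.hasDerivAt).const_add x0
  have hwv : ∀ᵐ t, t ∈ Ioo 0 b → w t = v t := by
    filter_upwards [hv0] with t ht htb
    rw [ht htb, hv]
    simp only
    congr 1
    refine intervalIntegral.integral_congr fun s hs => ?_
    rw [uIcc_of_le htb.1.le] at hs
    exact (hFe s ⟨hs.1, hs.2.trans (htb.2.le.trans hbT)⟩).symm
  have hyx : ∀ t ∈ Icc 0 b, y t = x t := by
    intro t ht
    simp only [hy, hx, pth]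
    congr 1
    refine intervalIntegral.integral_congr_ae ?_
    have hne : ∀ᵐ s : ℝ, s ≠ b := by simp [ae_iff]
    filter_upwards [hwv, hne] with s hs hsb hst
    rw [uIoc_of_le ht.1] at hst
    exact (hs ⟨hst.1, lt_of_le_of_ne (hst.2.trans ht.2) hsb⟩).symm
  refine ⟨y, v, hyd, hvc, fun t ht => ?_, hyx, hwv⟩
  rw [hyx t ht, ← hFe t ⟨ht.1, ht.2.trans hbT⟩]
  exact hvd t

end Minimizer

section Virial
variable {E : Type*} [NormedAddCommGroup E] [InnerProductSpace ℝ E] [FiniteDimensional ℝ E]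
variable {ι : Type*} [Fintype ι] {c : ι → ℝ} {L : ι → E →L[ℝ] P3}

lemma mono_aux {f f' : ℝ → ℝ} {a b : ℝ} (hf : ∀ t ∈ Icc a b, HasDerivAt f (f' t) t)
    (hf' : ∀ t ∈ Icc a b, 0 ≤ f' t) {t : ℝ} (ht : t ∈ Icc a b) : f a ≤ f t := by
  have : MonotoneOn f (Icc a b) := by
    refine monotoneOn_of_deriv_nonneg (convex_Icc a b)
      (fun t ht => (hf t ht).continuousAt.continuousWithinAt) ?_ ?_
    · intro t ht
      exact (hf t (interior_subset ht)).differentiableAt.differentiableWithinAt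
    · intro t ht
      rw [(hf t (interior_subset ht)).deriv]
      exact hf' t (interior_subset ht)
  exact this ⟨le_rfl, ht.1.trans ht.2⟩ ht ht.1

lemma FF_inner {x : E} (hx : CF L x) : ⟪FF c L x, x⟫ = - UR c L x := by
  unfold FF UR
  rw [inner_neg_left, sum_inner]
  congr 1
  refine Finset.sum_congr rfl fun i _ => ?_
  rw [real_inner_smul_left, ContinuousLinearMap.adjoint_inner_left, real_inner_self_eq_norm_sq]
  have : ‖L i x‖ ≠ 0 := norm_ne_zero_iff.mpr (hx i)
  field_simp

lemma energy_deriv {y v : ℝ → E} {t : ℝ} (hy : HasDerivAt y (v t) t)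
    (hv : HasDerivAt v (FF c L (y t)) t) (hcf : CF L (y t)) :
    HasDerivAt (fun t => (1/2) * ‖v t‖ ^ 2 - UR c L (y t)) 0 t := by
  have h1 := (hv.norm_sq).const_mul (1/2:ℝ)
  have h2 := (UR_hasFDerivAt (c := c) hcf).comp_hasDerivAt t hy
  have h3 := h1.sub h2
  refine h3.congr_deriv ?_
  rw [innerSL_apply_apply, real_inner_comm (FF c L (y t)) (v t)]
  ring

lemma energy_const {y v : ℝ → E} {a b : ℝ} (hy : ∀ t ∈ Icc a b, HasDerivAt y (v t) t)
    (hv : ∀ t ∈ Icc a b, HasDerivAt v (FF c L (y t)) t) (hcf : ∀ t ∈ Icc a b, CF L (y t)) :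
    ∀ t ∈ Icc a b, (1/2) * ‖v t‖ ^ 2 - UR c L (y t) = (1/2) * ‖v a‖ ^ 2 - UR c L (y a) := by
  have hd : ∀ t ∈ Icc a b, HasDerivAt (fun t => (1/2) * ‖v t‖ ^ 2 - UR c L (y t)) 0 t :=
    fun t ht => energy_deriv (hy t ht) (hv t ht) (hcf t ht)
  exact constant_of_has_deriv_right_zero (fun t ht => (hd t ht).continuousAt.continuousWithinAt)
    (fun t ht => (hd t ⟨ht.1, ht.2.le⟩).hasDerivWithinAt)

lemma virial {h : ℝ} (hh : 0 < h) {C : ℝ} {y v : ℝ → E} {τ : ℝ} (hτ : 0 < τ)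
    (hy : ∀ t ∈ Icc 0 τ, HasDerivAt y (v t) t) (hvc : Continuous v)
    (hv : ∀ t ∈ Icc 0 τ, HasDerivAt v (FF c L (y t)) t) (hcf : ∀ t ∈ Icc 0 τ, CF L (y t))
    (hU : ∀ t ∈ Icc 0 τ, h ≤ UR c L (y t))
    (hC : ∀ t ∈ Icc 0 τ, (1/2) * ∫ s in (0:ℝ)..t, ‖v s‖ ^ 2 ≤ C)
    (hτ1 : 2 * C ≤ h * τ) :
    h * τ ^ 2 / 4 ≤ (1/2) * ‖y 0‖ ^ 2 + τ * (‖y 0‖ * √(2 * UR c L (y 0)) + C) := by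
  have h0 : (0:ℝ) ∈ Icc 0 τ := ⟨le_rfl, hτ.le⟩
  have h1 : τ ∈ Icc 0 τ := ⟨hτ.le, le_rfl⟩
  set E0 := (1/2) * ‖v 0‖ ^ 2 - UR c L (y 0) with hE0
  have hen := energy_const hy hv hcf
  set A : ℝ → ℝ := fun t => (1/2) * ∫ s in (0:ℝ)..t, ‖v s‖ ^ 2 with hA
  have hAd : ∀ t, HasDerivAt A ((1/2) * ‖v t‖ ^ 2) t := fun t =>
    (((hvc.norm.pow 2).integral_hasStrictDerivAt 0 t).hasDerivAt).const_mul (1/2:ℝ)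
  have hA0 : A 0 = 0 := by simp [hA]
  have hE1 : E0 * τ ≤ C - h * τ := by
    have := mono_aux (f := fun t => A t - (h + E0) * t) (f' := fun t => (1/2) * ‖v t‖ ^ 2 - (h + E0))
      (fun t _ => ((hAd t).sub ((hasDerivAt_id t).const_mul (h + E0))).congr_deriv (by ring))
      (fun t ht => by have := hen t ht; have := hU t ht; linarith) h1
    have h2 := hC τ h1
    simp only [hA0] at this
    change A τ ≤ C at h2
    nlinarith
  have hE2 : E0 ≤ -h/2 := by
    by_contra hcon
    push Not at hcon
    nlinarith
  have hv0 : ‖v 0‖ ≤ √(2 * UR c L (y 0)) := Real.le_sqrt_of_sq_le (by linarith)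
  set K := ‖y 0‖ * √(2 * UR c L (y 0)) + C with hK
  have hD : ∀ t ∈ Icc 0 τ, ⟪y t, v t⟫ ≤ K - h / 2 * t := by
    intro t ht
    have := mono_aux (f := fun t => A t + E0 * t - ⟪y t, v t⟫) (f' := fun t => 0)
      (a := 0) (b := τ) (fun t ht => by
        have h3 := (hy t ht).inner ℝ (hv t ht)
        have h4 := ((hAd t).add ((hasDerivAt_id t).const_mul E0)).sub h3
        refine h4.congr_deriv ?_
        have h5 := hen t ht
        rw [real_inner_comm (FF c L (y t)) (y t), FF_inner (hcf t ht), real_inner_self_eq_norm_sq]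
        simp only [mul_one]
        linarith) (fun _ _ => le_rfl) ht
    have h6 := mono_aux (f := fun t => ⟪y t, v t⟫ - (A t + E0 * t)) (f' := fun t => 0)
      (a := 0) (b := τ) (fun t ht => by
        have h3 := (hy t ht).inner ℝ (hv t ht)
        have h4 := h3.sub ((hAd t).add ((hasDerivAt_id t).const_mul E0))
        refine h4.congr_deriv ?_
        have h5 := hen t ht
        rw [real_inner_comm (FF c L (y t)) (y t), FF_inner (hcf t ht), real_inner_self_eq_norm_sq]
        simp only [mul_one]
        linarith) (fun _ _ => le_rfl) ht
    simp only [hA0] at this h6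
    have h7 : ⟪y 0, v 0⟫ ≤ ‖y 0‖ * √(2 * UR c L (y 0)) :=
      (real_inner_le_norm _ _).trans (mul_le_mul_of_nonneg_left hv0 (norm_nonneg _))
    have h8 : A t ≤ C := hC t ht
    have h9 : E0 * t ≤ -h/2 * t := mul_le_mul_of_nonneg_right hE2 ht.1
    simp only [hK]
    linarith
  have hfin := mono_aux (f := fun t => K * t - h / 4 * t ^ 2 - (1/2) * ‖y t‖ ^ 2)
    (f' := fun t => K - h / 2 * t - ⟪y t, v t⟫) (a := 0) (b := τ)
    (fun t ht => by
      have h3 := ((hy t ht).norm_sq).const_mul (1/2:ℝ)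
      have h4 := (((hasDerivAt_id t).const_mul K).sub (((hasDerivAt_id t).pow 2).const_mul (h/4))).sub h3
      refine h4.congr_deriv ?_
      simp
      ring)
    (fun t ht => by have := hD t ht; linarith) h1
  have := sq_nonneg ‖y τ‖
  nlinarith

lemma virial_time {h : ℝ} (hh : 0 < h) (C a K : ℝ) :
    ∃ τ : ℝ, 1 ≤ τ ∧ 2 * C ≤ h * τ ∧ a + τ * K < h * τ ^ 2 / 4 := by
  refine ⟨1 + 2 * |C| / h + 4 * (|a| + |K| + 1) / h, ?_, ?_, ?_⟩
  · have : 0 ≤ 2 * |C| / h := by positivity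
    have : 0 ≤ 4 * (|a| + |K| + 1) / h := by positivity
    linarith
  · have h1 : 0 ≤ 4 * (|a| + |K| + 1) := by positivity
    have h2 := le_abs_self C
    field_simp
    nlinarith
  · set τ := 1 + 2 * |C| / h + 4 * (|a| + |K| + 1) / h with hτ
    have h1 : 1 ≤ τ := by
      have : 0 ≤ 2 * |C| / h := by positivity
      have : 0 ≤ 4 * (|a| + |K| + 1) / h := by positivity
      linarith
    have h2 : 4 * (|a| + |K| + 1) < h * τ := by
      have h3 : h * τ = h + 2 * |C| + 4 * (|a| + |K| + 1) := by rw [hτ]; field_simp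
      have := abs_nonneg C
      linarith
    have h3 := le_abs_self a
    have h4 := le_abs_self K
    have h5 := abs_nonneg a
    nlinarith

end Virial

section Brake
variable {E : Type*} [NormedAddCommGroup E] [InnerProductSpace ℝ E] [FiniteDimensional ℝ E]
variable {ι : Type*} [Fintype ι] {c : ι → ℝ} {L : ι → E →L[ℝ] P3}

lemma int_sq_eq {b t : ℝ} {w v : ℝ → E} (ht : t ∈ Icc 0 b)
    (hwv : ∀ᵐ t, t ∈ Ioo 0 b → w t = v t) :
    ∫ s in (0:ℝ)..t, ‖v s‖ ^ 2 = ∫ s in (0:ℝ)..t, ‖w s‖ ^ 2 := by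
  refine intervalIntegral.integral_congr_ae ?_
  have hne : ∀ᵐ s : ℝ, s ≠ b := by simp [ae_iff]
  filter_upwards [hwv, hne] with s hs hsb hst
  rw [uIoc_of_le ht.1] at hst
  rw [hs ⟨hst.1, lt_of_le_of_ne (hst.2.trans ht.2) hsb⟩]

lemma int_sq_le {T t : ℝ} {w : ℝ → E} (hw : MemLp w 2 (mu T)) (ht : t ∈ Icc 0 T) :
    (1/2) * ∫ s in (0:ℝ)..t, ‖w s‖ ^ 2 ≤ kin T w := by
  have h0 : (0:ℝ) ∈ Icc 0 T := ⟨le_rfl, ht.1.trans ht.2⟩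
  have h1 : T ∈ Icc 0 T := ⟨ht.1.trans ht.2, le_rfl⟩
  unfold kin
  rw [← intervalIntegral.integral_add_adjacent_intervals (MemLp.iisq hw h0 ht) (MemLp.iisq hw ht h1)]
  have : 0 ≤ ∫ s in t..T, ‖w s‖ ^ 2 := intervalIntegral.integral_nonneg ht.2 fun s _ => sq_nonneg _
  linarith

/-- rescaled competitor -/
lemma rescale {h : ℝ} {x0 : E} {T : ℝ} {y v : ℝ → E} (hy : ∀ t, HasDerivAt y (v t) t)
    (hvc : Continuous v) (hy0 : y 0 = x0) {t1 : ℝ} (ht1 : 0 < t1)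
    (hcf : ∀ t ∈ Icc 0 t1, CF L (y t)) (hU : ∀ t ∈ Icc 0 t1, h ≤ UR c L (y t))
    (hU1 : UR c L (y t1) = h) {k : ℝ} (hk : 0 < k) (hkT : k * t1 ≤ T) :
    ∃ w', MemLp w' 2 (mu T) ∧ (∀ t ∈ Icc 0 T, CF L (pth x0 w' t)) ∧
      actR c L h x0 T w' = k⁻¹ * ((1/2) * ∫ s in (0:ℝ)..t1, ‖v s‖ ^ 2) +
        k * ∫ s in (0:ℝ)..t1, (UR c L (y s) - h) := by
  have hkt : 0 < k * t1 := mul_pos hk ht1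
  have hT : 0 < T := hkt.trans_le hkT
  set w' : ℝ → E := (Set.Ioc 0 (k * t1)).indicator (fun t => k⁻¹ • v (k⁻¹ * t)) with hw'
  have hwin : ∀ t ∈ Set.Ioc 0 (k * t1), w' t = k⁻¹ • v (k⁻¹ * t) := fun t ht => indicator_of_mem ht _
  have hwout : ∀ t ∈ Set.Ioc (k * t1) T, w' t = 0 := fun t ht =>
    indicator_of_notMem (fun h => absurd h.2 (not_le.mpr ht.1)) _
  have hgc : Continuous (fun t => k⁻¹ • v (k⁻¹ * t)) := by fun_prop
  have hmem : MemLp w' 2 (mu T) := by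
    obtain ⟨Cc, hCc⟩ := (isCompact_Icc (a := (0:ℝ)) (b := T)).exists_bound_of_continuousOn
      hgc.continuousOn
    refine MemLp.indicator measurableSet_Ioc (MemLp.of_bound hgc.aestronglyMeasurable Cc ?_)
    unfold mu
    exact (ae_restrict_iff' measurableSet_Ioc).mpr
      (Eventually.of_forall fun t ht => hCc t ⟨ht.1.le, ht.2⟩)
  have hm0 : (0:ℝ) ∈ Icc 0 T := ⟨le_rfl, hT.le⟩
  have hm1 : k * t1 ∈ Icc 0 T := ⟨hkt.le, hkT⟩
  have hm2 : T ∈ Icc 0 T := ⟨hT.le, le_rfl⟩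
  have hp1 : ∀ t ∈ Icc 0 (k * t1), pth x0 w' t = y (k⁻¹ * t) := by
    intro t ht
    have e1 : ∫ s in (0:ℝ)..t, w' s = ∫ s in (0:ℝ)..t, k⁻¹ • v (k⁻¹ * s) := by
      rw [intervalIntegral.integral_of_le ht.1, intervalIntegral.integral_of_le ht.1]
      exact setIntegral_congr_fun measurableSet_Ioc fun s hs => hwin s ⟨hs.1, hs.2.trans ht.2⟩
    have e2 : ∫ s in (0:ℝ)..t, k⁻¹ • v (k⁻¹ * s) = y (k⁻¹ * t) - y (k⁻¹ * 0) := by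
      refine intervalIntegral.integral_eq_sub_of_hasDerivAt (f := fun s => y (k⁻¹ * s)) ?_
        (hgc.intervalIntegrable _ _)
      intro s _
      have := (hy (k⁻¹ * s)).scomp s ((hasDerivAt_id s).const_mul k⁻¹)
      simpa [Function.comp_def] using this
    rw [pth, e1, e2, mul_zero, hy0]
    abel
  have hp2 : ∀ t ∈ Icc (k * t1) T, pth x0 w' t = y t1 := by
    intro t ht
    have e1 : ∫ s in (0:ℝ)..t, w' s = (∫ s in (0:ℝ)..(k * t1), w' s) + ∫ s in (k * t1)..t, w' s :=
      (intervalIntegral.integral_add_adjacent_intervals (MemLp.ii hmem hm0 hm1)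
        (MemLp.ii hmem hm1 ⟨hkt.le.trans ht.1, ht.2⟩)).symm
    have e2 : ∫ s in (k * t1)..t, w' s = 0 := by
      rw [intervalIntegral.integral_of_le ht.1]
      rw [setIntegral_congr_fun measurableSet_Ioc fun s hs => hwout s ⟨hs.1, hs.2.trans ht.2⟩]
      simp
    have e3 := hp1 (k * t1) ⟨hkt.le, le_rfl⟩
    rw [pth, e1, e2, add_zero]
    rw [pth] at e3
    rw [e3, ← mul_assoc, inv_mul_cancel₀ hk.ne', one_mul]
  have hsc : ∀ t ∈ Icc 0 (k * t1), k⁻¹ * t ∈ Icc 0 t1 := by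
    intro t ht
    refine ⟨mul_nonneg (inv_nonneg.mpr hk.le) ht.1, ?_⟩
    rw [inv_mul_le_iff₀ hk]; exact ht.2
  have hcf' : ∀ t ∈ Icc 0 T, CF L (pth x0 w' t) := by
    intro t ht
    rcases le_total t (k * t1) with h1 | h1
    · rw [hp1 t ⟨ht.1, h1⟩]; exact hcf _ (hsc t ⟨ht.1, h1⟩)
    · rw [hp2 t ⟨h1, ht.2⟩]; exact hcf _ ⟨ht1.le, le_rfl⟩
  refine ⟨w', hmem, hcf', ?_⟩
  have hk1 : k⁻¹ * (k * t1) = t1 := by rw [← mul_assoc, inv_mul_cancel₀ hk.ne', one_mul]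
  unfold actR kin
  congr 1
  · rw [← intervalIntegral.integral_add_adjacent_intervals (MemLp.iisq hmem hm0 hm1)
      (MemLp.iisq hmem hm1 hm2)]
    have e2 : ∫ s in (k * t1)..T, ‖w' s‖ ^ 2 = 0 := by
      rw [intervalIntegral.integral_of_le hkT]
      rw [setIntegral_congr_fun (g := fun _ => (0:ℝ)) measurableSet_Ioc
        fun s hs => by simp [hwout s hs]]
      simp
    have e1 : ∫ s in (0:ℝ)..(k * t1), ‖w' s‖ ^ 2 =
        ∫ s in (0:ℝ)..(k * t1), (k⁻¹ ^ 2) * ‖v (k⁻¹ * s)‖ ^ 2 := by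
      rw [intervalIntegral.integral_of_le hkt.le, intervalIntegral.integral_of_le hkt.le]
      refine setIntegral_congr_fun measurableSet_Ioc fun s hs => ?_
      simp only [hwin s hs, norm_smul, Real.norm_eq_abs, mul_pow, sq_abs]
    have e3 := intervalIntegral.integral_comp_mul_left (a := 0) (b := k * t1)
      (fun s => ‖v s‖ ^ 2) (inv_ne_zero hk.ne')
    rw [hk1, mul_zero] at e3
    rw [e1, e2, intervalIntegral.integral_const_mul, e3, inv_inv, smul_eq_mul]
    field_simp
    simp
  · rw [← intervalIntegral.integral_add_adjacent_intervals (pot_ii hT.le hmem hcf' hm0 hm1)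
      (pot_ii hT.le hmem hcf' hm1 hm2)]
    have e2 : ∫ s in (k * t1)..T, max (UR c L (pth x0 w' s) - h) 0 = 0 := by
      rw [intervalIntegral.integral_of_le hkT]
      rw [setIntegral_congr_fun (g := fun _ => (0:ℝ)) measurableSet_Ioc
        fun s hs => by simp [hp2 s ⟨hs.1.le, hs.2⟩, hU1]]
      simp
    have e1 : ∫ s in (0:ℝ)..(k * t1), max (UR c L (pth x0 w' s) - h) 0 =
        ∫ s in (0:ℝ)..(k * t1), (UR c L (y (k⁻¹ * s)) - h) := by
      rw [intervalIntegral.integral_of_le hkt.le, intervalIntegral.integral_of_le hkt.le]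
      refine setIntegral_congr_fun measurableSet_Ioc fun s hs => ?_
      have hs' : s ∈ Icc 0 (k * t1) := ⟨hs.1.le, hs.2⟩
      simp only [hp1 s hs']
      exact max_eq_left (by have := hU _ (hsc s hs'); linarith)
    have e3 := intervalIntegral.integral_comp_mul_left (a := 0) (b := k * t1)
      (fun s => UR c L (y s) - h) (inv_ne_zero hk.ne')
    rw [hk1, mul_zero] at e3
    rw [e1, e2, e3, inv_inv, smul_eq_mul, add_zero]

lemma stat_eq {A B k1 : ℝ} (hk1 : 1 < k1)
    (hk : ∀ k, 0 < k → k ≤ k1 → A + B ≤ k⁻¹ * A + k * B) : A = B := by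
  have hloc : IsLocalMin (fun k : ℝ => k⁻¹ * A + k * B) 1 := by
    filter_upwards [Ioo_mem_nhds zero_lt_one hk1] with k hk'
    have := hk k hk'.1 hk'.2.le
    simpa using this
  have hd : HasDerivAt (fun k : ℝ => k⁻¹ * A + k * B) (-A + B) 1 := by
    have h1 := (hasDerivAt_inv (one_ne_zero (α := ℝ))).mul_const A
    have h2 := (hasDerivAt_id (1:ℝ)).mul_const B
    refine (h1.add h2).congr_deriv ?_
    simp
  have := hloc.hasDerivAt_eq_zero hd
  linarith

theorem brake (hc : ∀ i, 0 < c i) {h : ℝ} (hh : 0 < h)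
    (hj : ∀ i, ∃ j : P3 →L[ℝ] E, ∃ s : ι → ℝ, s i ≠ 0 ∧ ∀ k z, L k (j z) = s k • z)
    {x0 : E} (hx0 : CF L x0) (hU : h ≤ UR c L x0) :
    ∃ t1 : ℝ, 0 ≤ t1 ∧ ∃ y v : ℝ → E, (∀ t, HasDerivAt y (v t) t) ∧
      (∀ t ∈ Icc 0 t1, HasDerivAt v (FF c L (y t)) t) ∧ (∀ t ∈ Icc 0 t1, CF L (y t)) ∧
      y 0 = x0 ∧ v t1 = 0 ∧ UR c L (y t1) = h := by
  rcases hU.eq_or_lt with hUe | hUl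
  · refine ⟨0, le_rfl, fun t => x0 + (t ^ 2 / 2) • FF c L x0, fun t => t • FF c L x0, ?_, ?_, ?_, ?_, ?_, ?_⟩
    · intro t
      have h1 : HasDerivAt (fun t : ℝ => t ^ 2 / 2) t t := by
        refine (((hasDerivAt_id t).pow 2).div_const 2).congr_deriv ?_
        simp
      exact (h1.smul_const _).const_add _
    · intro t ht
      have : t = 0 := le_antisymm ht.2 ht.1
      subst this
      refine ((hasDerivAt_id (0:ℝ)).smul_const (FF c L x0)).congr_deriv ?_
      simp
    · intro t ht
      have : t = 0 := le_antisymm ht.2 ht.1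
      subst this
      simpa using hx0
    · simp
    · simp
    · simp [hUe]
  obtain ⟨C, hC0, hC⟩ := minimizer hc hh hj hx0 hU
  obtain ⟨τ, hτ1, hτC, hτ2⟩ := virial_time hh C ((1/2) * ‖x0‖ ^ 2) (‖x0‖ * √(2 * UR c L x0) + C)
  have hτ0 : 0 < τ := zero_lt_one.trans_le hτ1
  set T := τ + 1 with hTdef
  have hτT : τ < T := by linarith
  have hT0 : 0 ≤ T := by linarith
  obtain ⟨w, hw, hwi, hcf, hwC, hmin⟩ := hC T (by linarith)
  set x := pth x0 w with hx
  have hxc : Continuous x := pth_cont x0 hwi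
  have hx00 : x 0 = x0 := pth_zero x0 w
  have hUc : ContinuousOn (fun t => UR c L (x t)) (Icc 0 T) := UR_contOn.comp hxc.continuousOn hcf
  have hm0 : (0:ℝ) ∈ Icc 0 T := ⟨le_rfl, hT0⟩
  have hm2 : T ∈ Icc 0 T := ⟨hT0, le_rfl⟩
  have hkinC : kin T w ≤ C := by
    refine le_trans ?_ hwC
    unfold actR
    exact le_add_of_nonneg_right (intervalIntegral.integral_nonneg hT0 fun t _ => le_max_right _ _)
  have hex : ∃ t ∈ Icc 0 τ, UR c L (x t) ≤ h := by
    by_contra hcon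
    push Not at hcon
    obtain ⟨y, v, hy, hvc, hv, hyx, hwv⟩ := sol_on hT0 hw hwi hcf hmin hτ0 hτT.le
      (fun t ht => hcon t ⟨ht.1.le, ht.2.le⟩)
    have hy0 : y 0 = x0 := by rw [hyx 0 ⟨le_rfl, hτ0.le⟩, pth_zero]
    have := virial hh hτ0 (fun t _ => hy t) hvc hv
      (fun t ht => by rw [hyx t ht]; exact hcf t ⟨ht.1, ht.2.trans hτT.le⟩)
      (fun t ht => by rw [hyx t ht]; exact (hcon t ht).le)
      (C := C) (fun t ht => by
        rw [int_sq_eq ht hwv]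
        exact (int_sq_le hw ⟨ht.1, ht.2.trans hτT.le⟩).trans hkinC) hτC
    rw [hy0] at this
    linarith
  have hUcτ : ContinuousOn (fun t => UR c L (x t)) (Icc 0 τ) := hUc.mono (Icc_subset_Icc_right hτT.le)
  have hScl : IsClosed (Icc 0 τ ∩ (fun t => UR c L (x t)) ⁻¹' Iic h) :=
    hUcτ.preimage_isClosed_of_isClosed isClosed_Icc isClosed_Iic
  have hSco : IsCompact (Icc 0 τ ∩ (fun t => UR c L (x t)) ⁻¹' Iic h) :=
    isCompact_Icc.of_isClosed_subset hScl inter_subset_left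
  obtain ⟨t1, ⟨ht1, ht1U⟩, ht1l⟩ := hSco.exists_isLeast (by
    obtain ⟨t, ht, ht'⟩ := hex
    exact ⟨t, ht, ht'⟩)
  have ht1U : UR c L (x t1) ≤ h := ht1U
  have hbef : ∀ t, 0 ≤ t → t < t1 → h < UR c L (x t) := by
    intro t h0 hlt
    by_contra hcon
    exact absurd (ht1l ⟨⟨h0, hlt.le.trans ht1.2⟩, not_lt.mp hcon⟩) (not_le.mpr hlt)
  have ht10 : 0 < t1 := by
    rcases ht1.1.eq_or_lt with h0 | h0
    · rw [← h0, hx00] at ht1U; linarith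
    · exact h0
  have ht1T : t1 < T := ht1.2.trans_lt hτT
  have ht1e : UR c L (x t1) = h := by
    have := intermediate_value_Icc' ht10.le (hUc.mono (Icc_subset_Icc_right ht1T.le))
    obtain ⟨t, ht, hte⟩ := this ⟨ht1U, by rw [hx00]; exact hU⟩
    simp only at hte
    rcases ht.2.eq_or_lt with h1 | h1
    · rw [← h1]; exact hte
    · exact absurd hte (hbef t ht.1 h1).ne'
  have hm1 : t1 ∈ Icc 0 T := ⟨ht10.le, ht1T.le⟩
  obtain ⟨y, v, hy, hvc, hv, hyx, hwv⟩ := sol_on hT0 hw hwi hcf hmin ht10 ht1T.le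
      (fun t ht => hbef t ht.1.le ht.2)
  have hy0 : y 0 = x0 := by rw [hyx 0 ⟨le_rfl, ht10.le⟩, pth_zero]
  have hycf : ∀ t ∈ Icc 0 t1, CF L (y t) := fun t ht => by
    rw [hyx t ht]; exact hcf t ⟨ht.1, ht.2.trans ht1T.le⟩
  have hyU : ∀ t ∈ Icc 0 t1, h ≤ UR c L (y t) := fun t ht => by
    rw [hyx t ht]
    rcases ht.2.eq_or_lt with h1 | h1
    · rw [h1]; exact ht1e.ge
    · exact (hbef t ht.1 h1).le
  have hyU1 : UR c L (y t1) = h := by rw [hyx t1 ⟨ht10.le, le_rfl⟩]; exact ht1e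
  have hyc : Continuous y := continuous_iff_continuousAt.mpr fun t => (hy t).continuousAt
  have hUyc : ContinuousOn (fun t => UR c L (y t)) (Icc 0 t1) := UR_contOn.comp hyc.continuousOn hycf
  set A := (1/2) * ∫ s in (0:ℝ)..t1, ‖v s‖ ^ 2 with hA
  set B := ∫ s in (0:ℝ)..t1, (UR c L (y s) - h) with hB
  have hlow : A + B ≤ actR c L h x0 T w := by
    unfold actR
    refine add_le_add ?_ ?_
    · rw [hA, int_sq_eq ⟨ht10.le, le_rfl⟩ hwv]
      exact int_sq_le hw hm1
    · rw [← intervalIntegral.integral_add_adjacent_intervals (pot_ii hT0 hw hcf hm0 hm1)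
        (pot_ii hT0 hw hcf hm1 hm2)]
      have e1 : ∫ s in (0:ℝ)..t1, max (UR c L (pth x0 w s) - h) 0 = B := by
        rw [hB]
        refine intervalIntegral.integral_congr fun s hs => ?_
        rw [uIcc_of_le ht10.le] at hs
        rw [show pth x0 w s = y s from (hyx s hs).symm]
        exact max_eq_left (by have := hyU s hs; linarith)
      have e2 : 0 ≤ ∫ s in t1..T, max (UR c L (pth x0 w s) - h) 0 :=
        intervalIntegral.integral_nonneg ht1T.le fun t _ => le_max_right _ _
      linarith
  have hAB : A = B := by
    refine stat_eq (k1 := T / t1) ((one_lt_div ht10).mpr ht1T) fun k hk hk1 => ?_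
    obtain ⟨w', hw', hcf', hact⟩ := rescale hy hvc hy0 ht10 hycf hyU hyU1 hk ((le_div_iff₀ ht10).mp hk1)
    rw [← hact]
    exact hlow.trans (hmin w' hw' hcf')
  refine ⟨t1, ht10.le, y, v, hy, hv, hycf, hy0, ?_, hyU1⟩
  have hen := energy_const (a := 0) (b := t1) (fun t _ => hy t) hv hycf
  set e := (1/2) * ‖v 0‖ ^ 2 - UR c L (y 0) with he
  have hIint : A - B = (e + h) * t1 := by
    rw [hA, hB, ← intervalIntegral.integral_const_mul, ← intervalIntegral.integral_sub]
    · rw [intervalIntegral.integral_congr (g := fun _ => e + h)]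
      · rw [intervalIntegral.integral_const, sub_zero, smul_eq_mul, mul_comm]
      · intro s hs
        rw [uIcc_of_le ht10.le] at hs
        have := hen s hs
        simp only
        linarith
    · exact (by fun_prop : Continuous fun s => (1/2) * ‖v s‖ ^ 2).intervalIntegrable _ _
    · refine ContinuousOn.intervalIntegrable ?_
      rw [uIcc_of_le ht10.le]
      exact hUyc.sub continuousOn_const
  have heh : e + h = 0 := by
    have : (e + h) * t1 = 0 := by rw [← hIint, hAB, sub_self]
    exact (mul_eq_zero.mp this).resolve_right ht10.ne'
  have hfin := hen t1 ⟨ht10.le, le_rfl⟩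
  rw [hyU1] at hfin
  have : ‖v t1‖ ^ 2 = 0 := by linarith
  exact norm_eq_zero.mp (pow_eq_zero_iff two_ne_zero |>.mp this)

end Brake

section Extend
variable {E : Type*} [NormedAddCommGroup E] [InnerProductSpace ℝ E] [FiniteDimensional ℝ E]
variable {ι : Type*} [Fintype ι] {c : ι → ℝ} {L : ι → E →L[ℝ] P3}

variable (c L) in
def Sol (y v : ℝ → E) (t : ℝ) : Prop :=
  HasDerivAt y (v t) t ∧ HasDerivAt v (FF c L (y t)) t ∧ CF L (y t)

lemma local_sol {x0 : E} (hx0 : CF L x0) (v0 : E) (t0 : ℝ) :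
    ∃ ε > 0, ∃ y v : ℝ → E, y t0 = x0 ∧ v t0 = v0 ∧ ∀ t ∈ Ioo (t0 - ε) (t0 + ε), Sol c L y v t := by
  have hf : ContDiffAt ℝ 1 (fun z : E × E => (z.2, FF c L z.1)) (x0, v0) := by
    refine contDiffAt_snd.prodMk ?_
    exact ContDiffAt.comp (g := FF c L) (f := Prod.fst) (x0, v0) (FF_contDiffAt (c := c) hx0) contDiffAt_fst
  obtain ⟨α, hα0, ε, hε, hα⟩ :=
    hf.exists_forall_mem_closedBall_exists_eq_forall_mem_Ioo_hasDerivAt₀ t0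
  have hcont : ContinuousAt (fun t => (α t).1) t0 :=
    (hα t0 ⟨by linarith, by linarith⟩).continuousAt.fst
  have hev : ∀ᶠ t in 𝓝 t0, CF L (α t).1 :=
    hcont.preimage_mem_nhds (CF_open.mem_nhds (by simp only [hα0]; exact hx0))
  obtain ⟨δ, hδ, hball⟩ := Metric.eventually_nhds_iff_ball.mp hev
  refine ⟨min ε δ, lt_min hε hδ, fun t => (α t).1, fun t => (α t).2, by simp [hα0], by simp [hα0], ?_⟩
  intro t ht
  have h1 := hα t ⟨by linarith [ht.1, min_le_left ε δ], by linarith [ht.2, min_le_left ε δ]⟩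
  refine ⟨?_, ?_, hball t ?_⟩
  · exact h1.fst
  · exact h1.snd
  · rw [Real.ball_eq_Ioo]
    exact ⟨by linarith [ht.1, min_le_right ε δ], by linarith [ht.2, min_le_right ε δ]⟩

lemma glue_deriv {f1 f2 : ℝ → E} {a t : ℝ} {d : E} (hf : f1 a = f2 a)
    (h1 : t ≤ a → HasDerivAt f1 d t) (h2 : a ≤ t → HasDerivAt f2 d t) :
    HasDerivAt (fun s => if s < a then f1 s else f2 s) d t := by
  rcases lt_trichotomy t a with h | h | h
  · refine (h1 h.le).congr_of_eventuallyEq ?_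
    filter_upwards [Iio_mem_nhds h] with s hs
    exact if_pos hs
  · subst h
    have hl : HasDerivWithinAt (fun s => if s < t then f1 s else f2 s) d (Iic t) t := by
      refine (h1 le_rfl).hasDerivWithinAt.congr (fun s hs => ?_) (by simp [hf])
      rcases (show s ≤ t from hs).eq_or_lt with h | h
      · simp [h, hf]
      · simp [h]
    have hr : HasDerivWithinAt (fun s => if s < t then f1 s else f2 s) d (Ici t) t := by
      refine (h2 le_rfl).hasDerivWithinAt.congr (fun s hs => ?_) (by simp)
      simp [not_lt.mpr (show t ≤ s from hs)]
    have := hl.union hr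
    rwa [Iic_union_Ici, hasDerivWithinAt_univ] at this
  · refine (h2 h.le).congr_of_eventuallyEq ?_
    filter_upwards [Ioi_mem_nhds h] with s hs
    exact if_neg (not_lt.mpr (le_of_lt hs))

lemma glue_sol {y1 v1 y2 v2 : ℝ → E} {a t : ℝ} (hy : y1 a = y2 a) (hv : v1 a = v2 a)
    (h1 : t ≤ a → Sol c L y1 v1 t) (h2 : a ≤ t → Sol c L y2 v2 t) :
    Sol c L (fun s => if s < a then y1 s else y2 s) (fun s => if s < a then v1 s else v2 s) t := by
  have ey : ∀ t ≤ a, (if t < a then y1 t else y2 t) = y1 t := fun t ht => by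
    rcases ht.eq_or_lt with h | h
    · simp [h, hy]
    · simp [h]
  have ev : ∀ t ≤ a, (if t < a then v1 t else v2 t) = v1 t := fun t ht => by
    rcases ht.eq_or_lt with h | h
    · simp [h, hv]
    · simp [h]
  refine ⟨glue_deriv hy (fun h => ?_) (fun h => ?_), glue_deriv hv (fun h => ?_) (fun h => ?_), ?_⟩
  · simp only [ev t h]; exact (h1 h).1
  · simp only [not_lt.mpr h, if_false]; exact (h2 h).1
  · simp only [ey t h]; exact (h1 h).2.1
  · simp only [not_lt.mpr h, if_false]; exact (h2 h).2.1
  · rcases lt_or_ge t a with h | h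
    · simp only [h, if_true]; exact (h1 h.le).2.2
    · simp only [not_lt.mpr h, if_false]; exact (h2 h).2.2

theorem brake_open (hc : ∀ i, 0 < c i) {h : ℝ} (hh : 0 < h)
    (hj : ∀ i, ∃ j : P3 →L[ℝ] E, ∃ s : ι → ℝ, s i ≠ 0 ∧ ∀ k z, L k (j z) = s k • z)
    {x0 : E} (hx0 : CF L x0) (hU : h ≤ UR c L x0) :
    ∃ a b : ℝ, ∃ y v : ℝ → E, (∀ t ∈ Ioo a b, Sol c L y v t) ∧
      (∀ t ∈ Ioo a b, (1/2) * ‖v t‖ ^ 2 - UR c L (y t) = -h) ∧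
      (∃ t ∈ Ioo a b, y t = x0) ∧ (∃ t ∈ Ioo a b, v t = 0) := by
  obtain ⟨t1, ht1, y, v, hy, hv, hcf, hy0, hv1, hU1⟩ := brake hc hh hj hx0 hU
  have hm0 : (0:ℝ) ∈ Icc 0 t1 := ⟨le_rfl, ht1⟩
  have hm1 : t1 ∈ Icc 0 t1 := ⟨ht1, le_rfl⟩
  have hS : ∀ t ∈ Icc 0 t1, Sol c L y v t := fun t ht => ⟨hy t, hv t ht, hcf t ht⟩
  obtain ⟨ε0, hε0, y0, v0, hy00, hv00, hs0⟩ := local_sol (c := c) (hcf 0 hm0) (v 0) 0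
  obtain ⟨ε1, hε1, y1, v1, hy11, hv11, hs1⟩ := local_sol (c := c) (hcf t1 hm1) (v t1) t1
  set ya : ℝ → E := fun s => if s < t1 then y s else y1 s with hya
  set va : ℝ → E := fun s => if s < t1 then v s else v1 s with hva
  have hSa : ∀ t ∈ Ico 0 (t1 + ε1), Sol c L ya va t := fun t ht =>
    glue_sol hy11.symm hv11.symm (fun h => hS t ⟨ht.1, h⟩) (fun h => hs1 t ⟨by linarith, ht.2⟩)
  have hya' : ∀ t ∈ Icc 0 t1, ya t = y t := fun t ht => by
    rcases ht.2.eq_or_lt with h | h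
    · simp [hya, h, hy11]
    · simp [hya, h]
  have hva' : ∀ t ∈ Icc 0 t1, va t = v t := fun t ht => by
    rcases ht.2.eq_or_lt with h | h
    · simp [hva, h, hv11]
    · simp [hva, h]
  set yb : ℝ → E := fun s => if s < 0 then y0 s else ya s with hyb
  set vb : ℝ → E := fun s => if s < 0 then v0 s else va s with hvb
  have hSb : ∀ t ∈ Ioo (-ε0) (t1 + ε1), Sol c L yb vb t := fun t ht =>
    glue_sol (by rw [hy00, hya' 0 hm0]) (by rw [hv00, hva' 0 hm0])
      (fun h => hs0 t ⟨by linarith [ht.1], by linarith⟩) (fun h => hSa t ⟨h, ht.2⟩)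
  have hyb' : ∀ t ∈ Icc 0 t1, yb t = y t := fun t ht => by
    simp only [hyb, not_lt.mpr ht.1, if_false]; exact hya' t ht
  have hvb' : ∀ t ∈ Icc 0 t1, vb t = v t := fun t ht => by
    simp only [hvb, not_lt.mpr ht.1, if_false]; exact hva' t ht
  have hJ1 : t1 ∈ Ioo (-ε0) (t1 + ε1) := ⟨by linarith, by linarith⟩
  have hJ0 : (0:ℝ) ∈ Ioo (-ε0) (t1 + ε1) := ⟨by linarith, by linarith⟩
  refine ⟨-ε0, t1 + ε1, yb, vb, hSb, ?_, ⟨0, hJ0, by rw [hyb' 0 hm0, hy0]⟩,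
    ⟨t1, hJ1, by rw [hvb' t1 hm1, hv1]⟩⟩
  have hen1 : (1/2) * ‖vb t1‖ ^ 2 - UR c L (yb t1) = -h := by
    rw [hvb' t1 hm1, hyb' t1 hm1, hv1, hU1]; simp
  intro t ht
  rcases le_total t t1 with h | h
  · have hsub : ∀ s ∈ Icc t t1, Sol c L yb vb s := fun s hs =>
      hSb s ⟨ht.1.trans_le hs.1, hs.2.trans_lt hJ1.2⟩
    rw [← hen1]
    exact (energy_const (fun s hs => (hsub s hs).1) (fun s hs => (hsub s hs).2.1)
      (fun s hs => (hsub s hs).2.2) t1 ⟨h, le_rfl⟩).symm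
  · have hsub : ∀ s ∈ Icc t1 t, Sol c L yb vb s := fun s hs =>
      hSb s ⟨hJ1.1.trans_le hs.1, hs.2.trans_lt ht.2⟩
    rw [← hen1]
    exact energy_const (fun s hs => (hsub s hs).1) (fun s hs => (hsub s hs).2.1)
      (fun s hs => (hsub s hs).2.2) t ⟨h, le_rfl⟩

end Extend

section Concrete
variable {N : ℕ}

abbrev EE (N : ℕ) := PiLp 2 (fun _ : Fin N => P3)
abbrev PR (N : ℕ) := {p : Fin N × Fin N // p.1 < p.2}

def LL (m : Fin N → ℝ) (p : PR N) : EE N →L[ℝ] P3 :=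
  (√(m p.1.1))⁻¹ • PiLp.proj 2 (𝕜 := ℝ) (fun _ : Fin N => P3) p.1.1 -
    (√(m p.1.2))⁻¹ • PiLp.proj 2 (𝕜 := ℝ) (fun _ : Fin N => P3) p.1.2

def cc (G : ℝ) (m : Fin N → ℝ) (p : PR N) : ℝ := G * (m p.1.1 * m p.1.2)

def JJ (a : Fin N) : P3 →L[ℝ] EE N :=
  (PiLp.continuousLinearEquiv 2 ℝ (fun _ : Fin N => P3)).symm.toContinuousLinearMap ∘L
    ContinuousLinearMap.single ℝ (fun _ : Fin N => P3) a

lemma JJ_apply (a b : Fin N) (z : P3) : (JJ a z) b = if b = a then z else 0 := by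
  simp [JJ, Pi.single_apply]

lemma LL_apply (m : Fin N → ℝ) (p : PR N) (x : EE N) :
    LL m p x = (√(m p.1.1))⁻¹ • x p.1.1 - (√(m p.1.2))⁻¹ • x p.1.2 := by
  simp [LL]

lemma LL_JJ (m : Fin N → ℝ) (p : PR N) (a : Fin N) (z : P3) :
    LL m p (JJ a z) = ((√(m a))⁻¹ * ((if p.1.1 = a then 1 else 0) - (if p.1.2 = a then 1 else 0))) • z := by
  rw [LL_apply, JJ_apply, JJ_apply]
  split_ifs with h1 h2 h2
  · rw [h1, h2]; simp
  · rw [h1]; simp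
  · rw [h2]; simp
  · simp

lemma inner_JJ (x : EE N) (a : Fin N) (z : P3) : ⟪x, JJ a z⟫ = ⟪x a, z⟫ := by
  rw [PiLp.inner_apply]
  rw [Finset.sum_eq_single a]
  · simp [JJ_apply]
  · intro b _ hb; simp [JJ_apply, hb]
  · simp

lemma sum_pairs {M : Type*} [AddCommMonoid M] (f : Fin N → Fin N → M) :
    ∑ p : PR N, f p.1.1 p.1.2 = ∑ i, ∑ j, if i < j then f i j else 0 := by
  rw [← Fintype.sum_prod_type' (fun i j => if i < j then f i j else 0), ← Finset.sum_filter]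
  exact (Finset.sum_subtype _ (by simp) (fun p : Fin N × Fin N => f p.1 p.2)).symm

def toQ (m : Fin N → ℝ) (x : EE N) : Fin N → P3 := fun a => (√(m a))⁻¹ • x a

lemma LL_toQ (m : Fin N → ℝ) (p : PR N) (x : EE N) : LL m p x = toQ m x p.1.1 - toQ m x p.1.2 :=
  LL_apply m p x

lemma UR_toQ (G : ℝ) (m : Fin N → ℝ) (x : EE N) :
    UR (cc G m) (LL m) x =
      G * ∑ a : Fin N, ∑ b : Fin N, if a < b then m a * m b / ‖toQ m x a - toQ m x b‖ else 0 := by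
  unfold UR cc
  simp only [LL_toQ]
  rw [sum_pairs (fun i j => G * (m i * m j) * ‖toQ m x i - toQ m x j‖⁻¹), Finset.mul_sum]
  refine Finset.sum_congr rfl fun i _ => ?_
  rw [Finset.mul_sum]
  refine Finset.sum_congr rfl fun j _ => ?_
  split_ifs
  · rw [div_eq_mul_inv]; ring
  · simp

lemma kin_toQ (m : Fin N → ℝ) (hm : ∀ a, 0 < m a) (v : EE N) :
    (1/2) * ∑ a, m a * ‖toQ m v a‖ ^ 2 = (1/2) * ‖v‖ ^ 2 := by
  rw [PiLp.norm_sq_eq_of_L2]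
  congr 1
  refine Finset.sum_congr rfl fun a _ => ?_
  have h1 : √(m a) ^ 2 = m a := Real.sq_sqrt (hm a).le
  have h2 : √(m a) ≠ 0 := (Real.sqrt_pos.mpr (hm a)).ne'
  rw [toQ, norm_smul, mul_pow, norm_inv, Real.norm_of_nonneg (Real.sqrt_nonneg _), inv_pow, h1]
  have := (hm a).ne'
  field_simp

lemma FF_toQ (G : ℝ) (m : Fin N → ℝ) (hm : ∀ a, 0 < m a) (x : EE N) (a : Fin N) :
    m a • toQ m (FF (cc G m) (LL m) x) a = ∑ b ∈ Finset.univ.filter (fun b => b ≠ a),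
      (G * m a * m b / ‖toQ m x b - toQ m x a‖ ^ 3) • (toQ m x b - toQ m x a) := by
  have h1 : √(m a) ^ 2 = m a := Real.sq_sqrt (hm a).le
  have h2 : √(m a) ≠ 0 := (Real.sqrt_pos.mpr (hm a)).ne'
  refine ext_inner_right ℝ fun z => ?_
  set q := toQ m x with hq
  set g : Fin N → Fin N → ℝ := fun i j => G * m i * m j / ‖q j - q i‖ ^ 3 * ⟪q j - q i, z⟫ with hg
  have hga : ∀ i j, g i j = - g j i := by
    intro i j
    simp only [hg]
    rw [norm_sub_rev (q j) (q i), ← neg_sub (q i) (q j), inner_neg_left]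
    ring
  have hL : ⟪m a • toQ m (FF (cc G m) (LL m) x) a, z⟫ =
      √(m a) * ⟪FF (cc G m) (LL m) x, JJ a z⟫ := by
    rw [inner_JJ, toQ, smul_smul, real_inner_smul_left]
    congr 1
    nth_rewrite 1 [← h1]
    field_simp
  have hR : √(m a) * ⟪FF (cc G m) (LL m) x, JJ a z⟫ =
      ∑ p : PR N, (fun i j => g i j * ((if i = a then 1 else 0) - (if j = a then 1 else 0))) p.1.1 p.1.2 := by
    unfold FF
    rw [inner_neg_left, sum_inner, ← Finset.sum_neg_distrib, Finset.mul_sum]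
    refine Finset.sum_congr rfl fun p _ => ?_
    rw [real_inner_smul_left, ContinuousLinearMap.adjoint_inner_left, LL_JJ, real_inner_smul_right,
      LL_toQ, ← hq]
    simp only [hg, cc]
    rw [norm_sub_rev (q p.1.2) (q p.1.1), ← neg_sub (q p.1.1) (q p.1.2), inner_neg_left]
    field_simp
  rw [hL, hR, sum_pairs (fun i j => g i j * ((if i = a then (1:ℝ) else 0) - (if j = a then 1 else 0))),
    sum_inner]
  have e1 : ∀ i j : Fin N, (if i < j then g i j * ((if i = a then 1 else 0) - (if j = a then 1 else 0)) else 0)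
      = (if i = a then (if i < j then g i j else 0) else 0) -
        (if j = a then (if i < j then g i j else 0) else 0) := by
    intro i j; split_ifs <;> simp
  simp only [e1, Finset.sum_sub_distrib]
  rw [Finset.sum_comm]
  simp only [Finset.sum_ite_eq', Finset.mem_univ, if_true]
  rw [← Finset.sum_sub_distrib, Finset.sum_filter]
  refine Finset.sum_congr rfl fun j _ => ?_
  rw [real_inner_smul_left]
  change _ = if j ≠ a then g a j else 0
  rcases lt_trichotomy a j with h | h | h
  · simp [h, h.ne', not_lt.mpr h.le]
  · simp [h]
  · simp [h, h.ne, not_lt.mpr h.le, hga a j]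

lemma smul_clm_deriv {E : Type*} [NormedAddCommGroup E] [InnerProductSpace ℝ E] (P : E →L[ℝ] P3) (k : ℝ)
    {y : ℝ → E} {y' : E} {t : ℝ} (hy : HasDerivAt y y' t) :
    HasDerivAt (fun s => k • P (y s)) (k • P y') t :=
  (P.hasFDerivAt.comp_hasDerivAt t hy).const_smul k

theorem concrete (G : ℝ) (hG : 0 < G) (m : Fin N → ℝ) (hm : ∀ a, 0 < m a) (h : ℝ) (hh : 0 < h)
    (q₀ : Fin N → P3) (hq₀ : ∀ a b, a ≠ b → q₀ a ≠ q₀ b)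
    (hHill : h ≤ G * ∑ a : Fin N, ∑ b : Fin N, if a < b then m a * m b / ‖q₀ a - q₀ b‖ else 0) :
    ∃ a b : ℝ, ∃ q v : ℝ → Fin N → P3,
      (∀ t ∈ Ioo a b, (∀ i j, i ≠ j → q t i ≠ q t j) ∧ (∀ i, HasDerivAt (fun s => q s i) (v t i) t) ∧
        (∀ i, ∃ acc : P3, HasDerivAt (fun s => v s i) acc t ∧
          m i • acc = ∑ b ∈ Finset.univ.filter (fun b => b ≠ i),
        (G * m i * m b / ‖q t b - q t i‖ ^ 3) • (q t b - q t i))) ∧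
      (∀ t ∈ Ioo a b, (1/2) * ∑ i, m i * ‖v t i‖ ^ 2 -
        G * ∑ i : Fin N, ∑ j : Fin N, (if i < j then m i * m j / ‖q t i - q t j‖ else 0) = -h) ∧
      (∃ t ∈ Ioo a b, q t = q₀) ∧ (∃ t ∈ Ioo a b, ∀ i, v t i = 0) := by
  have hsq : ∀ a, √(m a) ≠ 0 := fun a => (Real.sqrt_pos.mpr (hm a)).ne'
  set x0 : EE N := WithLp.toLp 2 (fun a => √(m a) • q₀ a) with hx0
  have hQ0 : toQ m x0 = q₀ := by
    funext a
    simp [toQ, hx0, smul_smul, inv_mul_cancel₀ (hsq a)]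
  have hcf : CF (LL m) x0 := by
    intro p
    rw [LL_toQ, hQ0, sub_ne_zero]
    exact hq₀ _ _ p.2.ne
  have hc : ∀ p : PR N, 0 < cc G m p := fun p => mul_pos hG (mul_pos (hm _) (hm _))
  have hj : ∀ p : PR N, ∃ j : P3 →L[ℝ] EE N, ∃ s : PR N → ℝ, s p ≠ 0 ∧ ∀ k z, LL m k (j z) = s k • z := by
    intro p
    refine ⟨JJ p.1.1, fun k => (√(m p.1.1))⁻¹ * ((if k.1.1 = p.1.1 then 1 else 0) -
      (if k.1.2 = p.1.1 then 1 else 0)), ?_, fun k z => LL_JJ m k _ z⟩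
    simp [p.2.ne', hsq]
  obtain ⟨a, b, y, v, hS, hE, ⟨t0, ht0, hyt⟩, ⟨ts, hts, hvt⟩⟩ := brake_open hc hh hj hcf
    (by rw [UR_toQ, hQ0]; exact hHill)
  refine ⟨a, b, fun t => toQ m (y t), fun t => toQ m (v t), ?_, ?_, ⟨t0, ht0, ?_⟩, ⟨ts, hts, ?_⟩⟩
  · intro t ht
    obtain ⟨h1, h2, h3⟩ := hS t ht
    refine ⟨?_, fun i => smul_clm_deriv (PiLp.proj 2 (𝕜 := ℝ) (fun _ : Fin N => P3) i) (√(m i))⁻¹ h1, fun i => ⟨_, smul_clm_deriv (PiLp.proj 2 (𝕜 := ℝ) (fun _ : Fin N => P3) i) (√(m i))⁻¹ h2, FF_toQ G m hm (y t) i⟩⟩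
    intro i j hij
    rcases lt_or_gt_of_ne hij with hlt | hlt
    · have := h3 ⟨(i, j), hlt⟩
      rw [LL_toQ, sub_ne_zero] at this
      exact this
    · have := h3 ⟨(j, i), hlt⟩
      rw [LL_toQ, sub_ne_zero] at this
      exact this.symm
  · intro t ht
    rw [kin_toQ m hm, ← UR_toQ]
    exact hE t ht
  · simp only [hyt, hQ0]
  · intro i
    simp [toQ, hvt]

end Concrete

end Lost

/-- Lost Theorem: through every collision-free point `q₀` of the
Hill region `{U ≥ h}` there passes an energy `-h` brake orbit: a solution on
some open interval whose velocities all vanish at some instant. -/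
theorem lost_theorem
    (N : ℕ) (hN : 2 ≤ N) (G : ℝ) (hG : 0 < G)
    (m : Fin N → ℝ) (hm : ∀ a, 0 < m a)
    (h : ℝ) (hh : 0 < h)
    (q₀ : Config N) (hq₀ : CollisionFree q₀) (hHill : h ≤ potU G m q₀) :
    ∃ (J : Set ℝ) (q v : ℝ → Config N),
      IsOpen J ∧ J.OrdConnected ∧ J.Nonempty ∧
      IsSolutionOn G m J q v ∧
      (∀ t ∈ J, kinE m (v t) - potU G m (q t) = -h) ∧
      (∃ t₀ ∈ J, q t₀ = q₀) ∧
      (∃ ts ∈ J, ∀ a, v ts a = 0) := by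
  obtain ⟨a, b, q, v, hS, hE, ⟨t0, ht0, hq⟩, ts, hts, hv⟩ :=
    Lost.concrete G hG m hm h hh q₀ hq₀ hHill
  exact ⟨Set.Ioo a b, q, v, isOpen_Ioo, Set.ordConnected_Ioo, ⟨t0, ht0⟩, hS, hE,
    ⟨t0, ht0, hq⟩, ⟨ts, hts, hv⟩⟩
end
end

section
/- Finite diameter of the Jacobi–Maupertuis metric: fix h > 0. There exists a constant D > 0 such that any two collision-free configurations q and q′ with U(q) ≥ h and U(q′) ≥ h can be joined by a piecewise-C¹ path γ : [0,1] → {collision-free configurations with U ≥ h} with γ(0) = q, γ(1) = q′, and JM length L_h(γ) ≤ D. -/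
open Finset Filter MeasureTheory
open scoped RealInnerProductSpace

noncomputable section

/-- A path `γ : [0,1] → Config N` is piecewise `C¹`: continuous on `[0,1]` and
`C¹` on each subinterval of some finite partition `0 = p₀ < p₁ < ⋯ < pₙ = 1`. -/
def PiecewiseC1On {N : ℕ} (γ : ℝ → Config N) : Prop :=
  ContinuousOn γ (Set.Icc 0 1) ∧
  ∃ (n : ℕ) (p : Fin (n + 1) → ℝ), p 0 = 0 ∧ p (Fin.last n) = 1 ∧
    StrictMono p ∧
    ∀ i : Fin n, ContDiffOn ℝ 1 γ (Set.Icc (p i.castSucc) (p i.succ))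

/-- The Jacobi–Maupertuis length at energy `-h` of a path `γ : [0,1] → Config N`:
`L_h(γ) = ∫₀¹ √(2(U(γ(s)) - h)) √(∑ m_a |γ_a'(s)|²) ds`. -/
def JMlength {N : ℕ} (G : ℝ) (m : Fin N → ℝ) (h : ℝ) (γ : ℝ → Config N) : ℝ :=
  ∫ s in (0:ℝ)..1, Real.sqrt (2 * (potU G m (γ s) - h)) *
    Real.sqrt (∑ a : Fin N, m a * ‖deriv (fun u => γ u a) s‖ ^ 2)

/-- The JM integrand. -/
def jmDens {N : ℕ} (G : ℝ) (m : Fin N → ℝ) (h : ℝ) (γ : ℝ → Config N) (s : ℝ) : ℝ :=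
  Real.sqrt (2 * (potU G m (γ s) - h)) *
    Real.sqrt (∑ a : Fin N, m a * ‖deriv (fun u => γ u a) s‖ ^ 2)

/-- A `C¹` piece with bounded integrand inside the Hill region. -/
def JMPiece {N : ℕ} (G : ℝ) (m : Fin N → ℝ) (h B : ℝ) (f : ℝ → Config N) : Prop :=
  ContDiffOn ℝ 1 f (Set.Icc 0 1) ∧
  (∀ s ∈ Set.Icc (0:ℝ) 1, CollisionFree (f s) ∧ h ≤ potU G m (f s)) ∧
  ∀ s ∈ Set.Ioo (0:ℝ) 1, jmDens G m h f s ≤ B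

theorem jmDens_nonneg {N : ℕ} (G : ℝ) (m : Fin N → ℝ) (h : ℝ) (γ : ℝ → Config N) (s : ℝ) :
    0 ≤ jmDens G m h γ s := by
  unfold jmDens; positivity

theorem JMPiece.rev {N : ℕ} {G : ℝ} {m : Fin N → ℝ} {h B : ℝ} {f : ℝ → Config N}
    (hf : JMPiece G m h B f) : JMPiece G m h B (fun s => f (1 - s)) := by
  obtain ⟨h1, h2, h3⟩ := hf
  refine ⟨?_, ?_, ?_⟩
  · refine h1.comp (t := Set.Icc 0 1) (g := f) (f := fun s : ℝ => 1 - s) (by fun_prop) ?_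
    intro s hs
    exact ⟨by linarith [hs.2], by linarith [hs.1]⟩
  · intro s hs
    exact h2 (1 - s) ⟨by linarith [hs.2], by linarith [hs.1]⟩
  · intro s hs
    have := h3 (1 - s) ⟨by linarith [hs.2], by linarith [hs.1]⟩
    have e : ∀ a, deriv (fun u => f (1 - u) a) s = - deriv (fun u => f u a) (1 - s) := by
      intro a
      exact deriv_comp_const_sub (f := fun u => f u a) 1 s
    unfold jmDens at this ⊢
    simp only [e, norm_neg]
    exact this

theorem jmDens_affine {N : ℕ} (G : ℝ) (m : Fin N → ℝ) (h : ℝ) (f : ℝ → Config N) (c s : ℝ) :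
    jmDens G m h (fun u => f (4 * u - c)) s = 4 * jmDens G m h f (4 * s - c) := by
  have e : ∀ a, deriv (fun u => f (4 * u - c) a) s
      = (4:ℝ) • deriv (fun u => f u a) (4 * s - c) := by
    intro a
    have h1 := deriv_comp_mul_left (4:ℝ) (fun u => f (u - c) a) s
    have h2 := deriv_comp_sub_const (f := fun u => f u a) c (4 * s)
    rw [h1, h2]
  unfold jmDens
  simp only [e, norm_smul, mul_pow]
  have : ∑ x, m x * (‖(4:ℝ)‖ ^ 2 * ‖deriv (fun u => f u x) (4 * s - c)‖ ^ 2)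
      = 4 ^ 2 * ∑ x, m x * ‖deriv (fun u => f u x) (4 * s - c)‖ ^ 2 := by
    rw [Finset.mul_sum]
    refine Finset.sum_congr rfl fun x _ => ?_
    norm_num; ring
  rw [this, Real.sqrt_mul (x := 4 ^ 2) (by norm_num), Real.sqrt_sq (x := 4) (by norm_num)]
  ring

theorem jm_glue {N : ℕ} {G : ℝ} {m : Fin N → ℝ} {h B : ℝ}
    (f : ℕ → ℝ → Config N) (hf : ∀ i < 4, JMPiece G m h B (f i))
    (hj : ∀ i < 4, f i 1 = f (i + 1) 0) :
    ∃ γ : ℝ → Config N, PiecewiseC1On γ ∧ γ 0 = f 0 0 ∧ γ 1 = f 4 0 ∧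
        (∀ s ∈ Set.Icc (0:ℝ) 1, CollisionFree (γ s) ∧ h ≤ potU G m (γ s)) ∧
        JMlength G m h γ ≤ 4 * B := by
  set γ : ℝ → Config N := fun s => f ⌊4 * s⌋₊ (4 * s - ⌊4 * s⌋₊) with hγ
  have key : ∀ i : ℕ, i < 4 → ∀ s ∈ Set.Icc ((i:ℝ) / 4) (((i:ℝ) + 1) / 4), γ s = f i (4 * s - i) := by
    intro i hi s hs
    have hi0 : (0:ℝ) ≤ i := by positivity
    rcases hs.2.lt_or_eq with hlt | heq
    · have : ⌊4 * s⌋₊ = i := by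
        rw [Nat.floor_eq_iff (by linarith [hs.1])]
        exact ⟨by linarith [hs.1], by linarith⟩
      simp only [hγ, this]
    · have e : 4 * s = ((i + 1 : ℕ) : ℝ) := by rw [heq]; push_cast; ring
      simp only [hγ, e, Nat.floor_natCast, sub_self]
      rw [← hj i hi]; congr 1; push_cast; ring
  have cover : ∀ s ∈ Set.Icc (0:ℝ) 1, ∃ i : ℕ, i < 4 ∧ s ∈ Set.Icc ((i:ℝ) / 4) (((i:ℝ) + 1) / 4) := by
    intro s hs
    rcases le_total s (1/4) with h1 | h1
    · exact ⟨0, by norm_num, by constructor <;> norm_num <;> linarith [hs.1]⟩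
    rcases le_total s (1/2) with h2 | h2
    · exact ⟨1, by norm_num, by constructor <;> norm_num <;> linarith [hs.1]⟩
    rcases le_total s (3/4) with h3 | h3
    · exact ⟨2, by norm_num, by constructor <;> norm_num <;> linarith [hs.1]⟩
    · exact ⟨3, by norm_num, by constructor <;> norm_num <;> linarith [hs.1, hs.2]⟩
  have smooth : ∀ i : ℕ, i < 4 → ContDiffOn ℝ 1 γ (Set.Icc ((i:ℝ) / 4) (((i:ℝ) + 1) / 4)) := by
    intro i hi
    refine ContDiffOn.congr (f := fun s => f i (4 * s - i)) ?_ (key i hi)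
    refine (hf i hi).1.comp (t := Set.Icc 0 1) (g := f i) (f := fun s : ℝ => 4 * s - i)
      (by fun_prop) ?_
    intro s hs
    exact ⟨by linarith [hs.1], by linarith [hs.2]⟩
  refine ⟨γ, ⟨?_, 4, fun i => (i : ℝ) / 4, ?_, ?_, ?_, ?_⟩, ?_, ?_, ?_, ?_⟩
  · have hc : ContinuousOn γ (⋃ i : Fin 4, Set.Icc (((i:ℕ):ℝ) / 4) ((((i:ℕ):ℝ) + 1) / 4)) :=
      (locallyFinite_of_finite _).continuousOn_iUnion (fun i => isClosed_Icc)
        (fun i => (smooth i i.2).continuousOn)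
    refine hc.mono ?_
    intro s hs
    obtain ⟨i, hi, h'⟩ := cover s hs
    exact Set.mem_iUnion.2 ⟨⟨i, hi⟩, h'⟩
  · simp
  · simp
  · intro i j hij
    have : ((i:ℕ):ℝ) < ((j:ℕ):ℝ) := by exact_mod_cast hij
    show ((i:ℕ):ℝ) / 4 < ((j:ℕ):ℝ) / 4
    linarith
  · intro i
    have := smooth i i.2
    simpa using this
  · simp [hγ]
  · have : ⌊(4:ℝ)⌋₊ = 4 := by exact_mod_cast Nat.floor_natCast (R := ℝ) 4
    simp [hγ, this]
  · intro s hs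
    obtain ⟨i, hi, h'⟩ := cover s hs
    rw [key i hi s h']
    exact (hf i hi).2.1 _ ⟨by linarith [h'.1], by linarith [h'.2]⟩
  · have hb : ∀ i : ℕ, i < 4 → ∀ s ∈ Set.Ioo ((i:ℝ) / 4) (((i:ℝ) + 1) / 4),
        jmDens G m h γ s ≤ 4 * B := by
      intro i hi s hs
      have hev : γ =ᶠ[nhds s] fun u => f i (4 * u - i) := by
        filter_upwards [Ioo_mem_nhds hs.1 hs.2] with u hu
        exact key i hi u ⟨hu.1.le, hu.2.le⟩
      have e : jmDens G m h γ s = jmDens G m h (fun u => f i (4 * u - i)) s := by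
        unfold jmDens
        rw [hev.eq_of_nhds]
        congr 2
        refine Finset.sum_congr rfl fun a _ => ?_
        have hd : deriv (fun u => γ u a) s = deriv (fun u => f i (4 * u - i) a) s :=
          Filter.EventuallyEq.deriv_eq (hev.fun_comp (fun x : Config N => x a))
        rw [hd]
      rw [e, jmDens_affine]
      have := (hf i hi).2.2 (4 * s - i) ⟨by linarith [hs.1], by linarith [hs.2]⟩
      linarith
    have hfin : ({0, 1/4, 1/2, 3/4, 1} : Set ℝ).Finite := by simp
    have hae : ∀ᵐ s : ℝ, s ∉ ({0, 1/4, 1/2, 3/4, 1} : Set ℝ) :=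
      (measure_eq_zero_iff_ae_notMem).1 (hfin.measure_zero volume)
    have hint : ‖∫ s in (0:ℝ)..1, jmDens G m h γ s‖ ≤ 4 * B * |1 - 0| := by
      apply intervalIntegral.norm_integral_le_of_norm_le_const_ae
      filter_upwards [hae] with s hs hs'
      rw [Set.uIoc_of_le zero_le_one] at hs'
      rw [Real.norm_of_nonneg (jmDens_nonneg _ _ _ _ _)]
      obtain ⟨i, hi, h'⟩ := cover s ⟨hs'.1.le, hs'.2⟩
      refine hb i hi s ⟨lt_of_le_of_ne h'.1 ?_, lt_of_le_of_ne h'.2 ?_⟩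
      · rintro rfl
        apply hs
        interval_cases i <;> norm_num
      · rintro rfl
        apply hs
        interval_cases i <;> norm_num
    simp only [sub_zero, abs_one, mul_one] at hint
    exact (le_abs_self _).trans hint

/-- The total pair mass constant. -/
def pairK {N : ℕ} (G : ℝ) (m : Fin N → ℝ) : ℝ :=
  G * ∑ a : Fin N, ∑ b : Fin N, if a < b then m a * m b else 0

theorem pair_sum_pos {N : ℕ} (hN : 2 ≤ N) (F : Fin N → Fin N → ℝ)
    (hF : ∀ a b, a < b → 0 < F a b) :
    0 < ∑ a : Fin N, ∑ b : Fin N, if a < b then F a b else 0 := by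
  have h0 : ∀ a b : Fin N, 0 ≤ if a < b then F a b else 0 := by
    intro a b
    split_ifs with hab
    · exact (hF a b hab).le
    · exact le_rfl
  have hlt : (⟨0, by omega⟩ : Fin N) < ⟨1, by omega⟩ := by simp
  refine Finset.sum_pos' (fun a _ => Finset.sum_nonneg fun b _ => h0 a b)
    ⟨⟨0, by omega⟩, Finset.mem_univ _, ?_⟩
  refine Finset.sum_pos' (fun b _ => h0 _ b) ⟨⟨1, by omega⟩, Finset.mem_univ _, ?_⟩
  rw [if_pos hlt]
  exact hF _ _ hlt

theorem pairK_pos {N : ℕ} (hN : 2 ≤ N) {G : ℝ} (hG : 0 < G)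
    {m : Fin N → ℝ} (hm : ∀ a, 0 < m a) : 0 < pairK G m :=
  mul_pos hG (pair_sum_pos hN (fun a b => m a * m b) fun a b _ => mul_pos (hm a) (hm b))

theorem potU_pos {N : ℕ} (hN : 2 ≤ N) {G : ℝ} (hG : 0 < G)
    {m : Fin N → ℝ} (hm : ∀ a, 0 < m a) {q : Config N} (hq : CollisionFree q) :
    0 < potU G m q :=
  mul_pos hG (pair_sum_pos hN (fun a b => m a * m b / ‖q a - q b‖) fun a b hab =>
    div_pos (mul_pos (hm a) (hm b)) (norm_pos_iff.2 (sub_ne_zero.2 (hq a b hab.ne))))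

theorem potU_le {N : ℕ} {G : ℝ} (hG : 0 < G)
    {m : Fin N → ℝ} (hm : ∀ a, 0 < m a) {q : Config N} {r : ℝ} (hr : 0 < r)
    (hq : ∀ a b, a ≠ b → r ≤ ‖q a - q b‖) : potU G m q ≤ pairK G m / r := by
  unfold potU pairK
  rw [mul_div_assoc, Finset.sum_div]
  refine mul_le_mul_of_nonneg_left (Finset.sum_le_sum fun a _ => ?_) hG.le
  rw [Finset.sum_div]
  refine Finset.sum_le_sum fun b _ => ?_
  split_ifs with hab
  · exact div_le_div_of_nonneg_left (mul_pos (hm a) (hm b)).le hr (hq a b hab.ne)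
  · simp

theorem potU_smul {N : ℕ} (G : ℝ) (m : Fin N → ℝ) (q : Config N) {l : ℝ} (hl : 0 < l) :
    potU G m (l • q) = potU G m q / l := by
  unfold potU
  rw [mul_div_assoc, Finset.sum_div]
  congr 1
  refine Finset.sum_congr rfl fun a _ => ?_
  rw [Finset.sum_div]
  refine Finset.sum_congr rfl fun b _ => ?_
  split_ifs with hab
  · rw [Pi.smul_apply, Pi.smul_apply, ← smul_sub, norm_smul, Real.norm_of_nonneg hl.le, div_div,
      mul_comm l]
  · simp

theorem potU_contDiffOn {N : ℕ} (G : ℝ) (m : Fin N → ℝ) (c : ℝ → Config N) (S : Set ℝ)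
    (hc : ContDiff ℝ 1 c) (hcf : ∀ s ∈ S, CollisionFree (c s)) :
    ContDiffOn ℝ 1 (fun s => potU G m (c s)) S := by
  unfold potU
  refine contDiffOn_const.mul (ContDiffOn.sum fun a _ => ContDiffOn.sum fun b _ => ?_)
  by_cases hab : a < b
  · simp only [if_pos hab]
    have hne : ∀ s ∈ S, c s a - c s b ≠ 0 := fun s hs => sub_ne_zero.2 (hcf s hs a b hab.ne)
    have hd : ContDiffOn ℝ 1 (fun s => c s a - c s b) S :=
      ((contDiff_pi.1 hc a).sub (contDiff_pi.1 hc b)).contDiffOn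
    exact contDiffOn_const.div (hd.norm ℝ hne) fun s hs => norm_ne_zero_iff.2 (hne s hs)
  · simp only [if_neg hab]
    exact contDiffOn_const

theorem exists_rank {N : ℕ} (x : Fin N → ℝ) :
    ∃ r : Equiv.Perm (Fin N), ∀ a b, r a < r b → x a ≤ x b := by
  refine ⟨(Tuple.sort x).symm, fun a b hab => ?_⟩
  have := Tuple.monotone_sort x hab.le
  simpa using this

theorem coord_le_norm (v : EuclideanSpace ℝ (Fin 3)) (i : Fin 3) : |v i| ≤ ‖v‖ :=
  PiLp.norm_apply_le v i

theorem rank_gap {N : ℕ} (x : Fin N → ℝ) (r : Equiv.Perm (Fin N))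
    (hr : ∀ a b, r a < r b → x a ≤ x b) {k : ℝ} (hk : 0 ≤ k) {a b : Fin N} (hab : a ≠ b) :
    k ≤ |(x a + k * ((r a : ℕ) : ℝ)) - (x b + k * ((r b : ℕ) : ℝ))| := by
  have main : ∀ a b, r a < r b →
      k ≤ (x b + k * ((r b : ℕ) : ℝ)) - (x a + k * ((r a : ℕ) : ℝ)) := by
    intro a b hlt
    have h1 := hr a b hlt
    have h2 : ((r a : ℕ) : ℝ) + 1 ≤ ((r b : ℕ) : ℝ) := by exact_mod_cast hlt
    nlinarith
  rcases lt_or_gt_of_ne (fun e => hab (r.injective e)) with hlt | hlt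
  · rw [abs_sub_comm]
    exact (main a b hlt).trans (le_abs_self _)
  · exact (main b a hlt).trans (le_abs_self _)

/-- Phase one: spread along the first axis until the boundary `U = h` is reached. -/
theorem jm_phase1 {N : ℕ} (hN : 2 ≤ N) {G : ℝ} (hG : 0 < G)
    {m : Fin N → ℝ} (hm : ∀ a, 0 < m a) {h : ℝ} (hh : 0 < h) :
    ∃ B : ℝ, 0 < B ∧ ∀ q : Config N, CollisionFree q → h ≤ potU G m q →
      ∃ f : ℝ → Config N, JMPiece G m h B f ∧ f 0 = q ∧ potU G m (f 1) = h := by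
  have hK := pairK_pos hN hG hm
  set R : ℝ := pairK G m / h with hR
  have hR0 : 0 < R := div_pos hK hh
  have hKR : pairK G m / R = h := by rw [hR]; field_simp
  set M : ℝ := ∑ a, m a with hM
  have hM0 : 0 ≤ M := Finset.sum_nonneg fun a _ => (hm a).le
  refine ⟨Real.sqrt (8 * h * M * (R * N) ^ 2) + 1, by positivity, ?_⟩
  intro q hq hU
  obtain ⟨r, hr⟩ := exists_rank (fun a => q a 0)
  set v : Config N := fun a => (R * ((r a : ℕ) : ℝ)) • EuclideanSpace.single (0 : Fin 3) (1:ℝ)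
    with hv
  have hvn : ∀ a, ‖v a‖ ≤ R * N := by
    intro a
    simp only [hv, norm_smul, EuclideanSpace.norm_single, norm_one, mul_one]
    rw [Real.norm_of_nonneg (by positivity)]
    have : ((r a : ℕ) : ℝ) ≤ N := by exact_mod_cast (r a).2.le
    exact mul_le_mul_of_nonneg_left this hR0.le
  set c : ℝ → Config N := fun t => q + t • v with hc
  have hcd : ContDiff ℝ 1 c := by simp only [hc]; fun_prop
  have gap : ∀ t, 0 ≤ t → ∀ a b, a ≠ b → R * t ≤ ‖c t a - c t b‖ := by
    intro t ht a b hab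
    refine le_trans ?_ (coord_le_norm _ 0)
    have := rank_gap (fun a => q a 0) r hr (k := R * t) (by positivity) hab
    refine this.trans (le_of_eq ?_)
    congr 1
    simp [hc, hv]
    ring
  have hcf : ∀ t, 0 ≤ t → CollisionFree (c t) := by
    intro t ht
    rcases ht.eq_or_lt with rfl | ht
    · simpa [hc] using hq
    · intro a b hab e
      have := gap t ht.le a b hab
      rw [e, sub_self, norm_zero] at this
      nlinarith [mul_pos hR0 ht]
  have hUle : ∀ t, 0 < t → potU G m (c t) ≤ h / t := by
    intro t ht
    have := potU_le hG hm (mul_pos hR0 ht) (gap t ht.le)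
    rwa [← div_div, hKR] at this
  have hcont : ContinuousOn (fun t => potU G m (c t)) (Set.Icc 0 1) :=
    (potU_contDiffOn G m c _ hcd fun s hs => hcf s hs.1).continuousOn
  have hclosed : IsClosed (Set.Icc (0:ℝ) 1 ∩ (fun t => potU G m (c t)) ⁻¹' Set.Iic h) :=
    hcont.preimage_isClosed_of_isClosed isClosed_Icc isClosed_Iic
  have hcomp : IsCompact (Set.Icc (0:ℝ) 1 ∩ (fun t => potU G m (c t)) ⁻¹' Set.Iic h) :=
    isCompact_Icc.of_isClosed_subset hclosed Set.inter_subset_left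
  obtain ⟨t0, ⟨ht0, ht0h⟩, hleast⟩ := hcomp.exists_isLeast
    ⟨1, ⟨zero_le_one, le_rfl⟩, by simpa using hUle 1 one_pos⟩
  have hU0 : potU G m (c 0) = potU G m q := by simp [hc]
  have hUt0 : potU G m (c t0) = h := by
    have hivt := intermediate_value_Icc' ht0.1
      (hcont.mono (Set.Icc_subset_Icc_right ht0.2))
    obtain ⟨t, ht, hte⟩ := hivt ⟨ht0h, by simpa [hU0] using hU⟩
    have hte' : potU G m (c t) = h := hte
    have : t0 ≤ t := hleast ⟨⟨ht.1, ht.2.trans ht0.2⟩, hte'.le⟩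
    rwa [le_antisymm this ht.2]
  have hUge : ∀ t ∈ Set.Icc 0 t0, h ≤ potU G m (c t) := by
    intro t ht
    by_contra! hlt
    have : t0 ≤ t := hleast ⟨⟨ht.1, ht.2.trans ht0.2⟩, hlt.le⟩
    have e : t = t0 := le_antisymm ht.2 this
    rw [e, hUt0] at hlt
    exact lt_irrefl _ hlt
  refine ⟨fun s => c (t0 * s ^ 2), ⟨?_, ?_, ?_⟩, ?_, ?_⟩
  · exact (hcd.comp (by fun_prop)).contDiffOn
  · intro s hs
    have h0 : 0 ≤ t0 * s ^ 2 := mul_nonneg ht0.1 (sq_nonneg s)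
    refine ⟨hcf _ h0, hUge _ ⟨h0, ?_⟩⟩
    have : s ^ 2 ≤ 1 := by nlinarith [hs.1, hs.2]
    nlinarith [ht0.1]
  · intro s hs
    have hd : ∀ a, deriv (fun u => c (t0 * u ^ 2) a) s = (t0 * (2 * s)) • v a := by
      intro a
      have h1 : HasDerivAt (fun u : ℝ => t0 * u ^ 2) (t0 * (2 * s)) s := by
        simpa using (hasDerivAt_pow 2 s).const_mul t0
      have h2 := (h1.smul_const (v a)).const_add (q a)
      exact h2.deriv
    unfold jmDens
    simp only [hd]
    have hsum : ∑ a, m a * ‖(t0 * (2 * s)) • v a‖ ^ 2 ≤ M * ((t0 * (2 * s)) * (R * N)) ^ 2 := by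
      rw [hM, Finset.sum_mul]
      refine Finset.sum_le_sum fun a _ => mul_le_mul_of_nonneg_left ?_ (hm a).le
      rw [norm_smul, Real.norm_of_nonneg (mul_nonneg ht0.1 (by linarith [hs.1]))]
      refine pow_le_pow_left₀ (mul_nonneg (mul_nonneg ht0.1 (by linarith [hs.1]))
        (norm_nonneg _)) ?_ 2
      exact mul_le_mul_of_nonneg_left (hvn a) (mul_nonneg ht0.1 (by linarith [hs.1]))
    refine le_trans ?_ (le_add_of_nonneg_right zero_le_one)
    rcases ht0.1.eq_or_lt with h00 | hpos
    · simp only [← h00]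
      simp
    · have hs0 : 0 < s := hs.1
      have hts : 0 < t0 * s ^ 2 := by positivity
      have hU2 : 2 * (potU G m (c (t0 * s ^ 2)) - h) ≤ 2 * (h / (t0 * s ^ 2)) := by
        linarith [hUle _ hts]
      calc _ ≤ Real.sqrt (2 * (h / (t0 * s ^ 2))) *
            Real.sqrt (M * ((t0 * (2 * s)) * (R * N)) ^ 2) :=
            mul_le_mul (Real.sqrt_le_sqrt hU2) (Real.sqrt_le_sqrt hsum)
              (Real.sqrt_nonneg _) (Real.sqrt_nonneg _)
        _ = Real.sqrt (t0 * (8 * h * M * (R * N) ^ 2)) := by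
            rw [← Real.sqrt_mul (by positivity)]
            congr 1
            field_simp
            ring
        _ ≤ _ := by
            apply Real.sqrt_le_sqrt
            have : 0 ≤ 8 * h * M * (R * N) ^ 2 := by positivity
            nlinarith [ht0.2]
  · simp [hc]
  · simpa using hUt0

/-- The standard configuration: bodies equally spaced on the second axis. -/
def stdConf (N : ℕ) : Config N :=
  fun a => ((a : ℕ) : ℝ) • EuclideanSpace.single (1 : Fin 3) (1:ℝ)

/-- Phase two: travel inside the boundary `U = h` to a fixed configuration. -/
theorem jm_phase2 {N : ℕ} (hN : 2 ≤ N) {G : ℝ} (hG : 0 < G)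
    {m : Fin N → ℝ} (hm : ∀ a, 0 < m a) {h : ℝ} (hh : 0 < h)
    (x : Config N) (hx : CollisionFree x) (hU : potU G m x = h) :
    ∃ f : ℝ → Config N, JMPiece G m h 0 f ∧ f 0 = x ∧
      f 1 = (potU G m (stdConf N) / h) • stdConf N := by
  obtain ⟨r, hr⟩ := exists_rank (fun a => x a 0)
  set v : Config N := fun a => ((r a : ℕ) : ℝ) • EuclideanSpace.single (0 : Fin 3) (1:ℝ)
    with hv
  set c : ℝ → Config N := fun t => (1 - t) • (x + t • v) + t • stdConf N with hc
  have hcd : ContDiff ℝ 1 c := by simp only [hc]; fun_prop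
  have hc0 : c 0 = x := by simp [hc]
  have hc1 : c 1 = stdConf N := by simp [hc]
  have hcf : ∀ t ∈ Set.Icc (0:ℝ) 1, CollisionFree (c t) := by
    intro t ht
    rcases ht.1.eq_or_lt with rfl | h0
    · rwa [hc0]
    rcases ht.2.eq_or_lt with rfl | h1
    · rw [hc1]
      intro a b hab e
      apply hab
      have := congrArg (fun w : EuclideanSpace ℝ (Fin 3) => w 1) e
      simp [stdConf] at this
      exact Fin.ext this
    · intro a b hab e
      have e0 := congrArg (fun w : EuclideanSpace ℝ (Fin 3) => w 0) e
      have g := rank_gap (fun a => x a 0) r hr (k := t) h0.le hab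
      simp [hc, hv, stdConf] at e0
      have e1 : x a 0 + t * ((r a : ℕ) : ℝ) = x b 0 + t * ((r b : ℕ) : ℝ) := by
        refine mul_left_cancel₀ (sub_ne_zero.2 h1.ne') ?_
        linarith
      simp only [e1, sub_self, abs_zero] at g
      linarith
  have hpos : ∀ t ∈ Set.Icc (0:ℝ) 1, 0 < potU G m (c t) / h := fun t ht =>
    div_pos (potU_pos hN hG hm (hcf t ht)) hh
  have hUh : ∀ t ∈ Set.Icc (0:ℝ) 1, potU G m ((potU G m (c t) / h) • c t) = h := by
    intro t ht
    have := (potU_pos hN hG hm (hcf t ht)).ne'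
    rw [potU_smul G m _ (hpos t ht)]
    field_simp
  refine ⟨fun t => (potU G m (c t) / h) • c t, ⟨?_, ?_, ?_⟩, ?_, ?_⟩
  · exact ((potU_contDiffOn G m c _ hcd hcf).div_const h).smul hcd.contDiffOn
  · intro s hs
    refine ⟨?_, (hUh s hs).ge⟩
    intro a b hab e
    exact hcf s hs a b hab (smul_right_injective _ (hpos s hs).ne' e)
  · intro s hs
    unfold jmDens
    rw [hUh s ⟨hs.1.le, hs.2.le⟩]
    simp
  · simp only [hc0, hU, div_self hh.ne', one_smul]
  · simp only [hc1]

/-- finite diameter of the Jacobi–Maupertuis metric: for fixed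
`h > 0` there is a constant `D > 0` such that any two collision-free points of
the Hill region `{U ≥ h}` are joined by a piecewise-`C¹` path staying in the
collision-free Hill region whose JM length is at most `D`. -/
theorem JM_finite_diameter
    (N : ℕ) (hN : 2 ≤ N) (G : ℝ) (hG : 0 < G)
    (m : Fin N → ℝ) (hm : ∀ a, 0 < m a)
    (h : ℝ) (hh : 0 < h) :
    ∃ D > (0:ℝ), ∀ q q' : Config N,
      CollisionFree q → CollisionFree q' →
      h ≤ potU G m q → h ≤ potU G m q' →
      ∃ γ : ℝ → Config N,
        PiecewiseC1On γ ∧ γ 0 = q ∧ γ 1 = q' ∧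
        (∀ s ∈ Set.Icc (0:ℝ) 1, CollisionFree (γ s) ∧ h ≤ potU G m (γ s)) ∧
        JMlength G m h γ ≤ D := by
  obtain ⟨B, hB, h1⟩ := jm_phase1 hN hG hm hh
  refine ⟨4 * B, by positivity, ?_⟩
  intro q q' hq hq' hU hU'
  obtain ⟨f, hf, hf0, hf1⟩ := h1 q hq hU
  obtain ⟨f', hf', hf0', hf1'⟩ := h1 q' hq' hU'
  have hone : (1:ℝ) ∈ Set.Icc (0:ℝ) 1 := ⟨zero_le_one, le_rfl⟩
  obtain ⟨g, hg, hg0, hg1⟩ := jm_phase2 hN hG hm hh (f 1) (hf.2.1 1 hone).1 hf1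
  obtain ⟨g', hg', hg0', hg1'⟩ := jm_phase2 hN hG hm hh (f' 1) (hf'.2.1 1 hone).1 hf1'
  have up : ∀ {k : ℝ → Config N}, JMPiece G m h 0 k → JMPiece G m h B k :=
    fun hk => ⟨hk.1, hk.2.1, fun s hs => (hk.2.2 s hs).trans hB.le⟩
  let F : ℕ → ℝ → Config N := fun i =>
    match i with
    | 0 => f
    | 1 => g
    | 2 => fun s => g' (1 - s)
    | 3 => fun s => f' (1 - s)
    | _ => fun _ => q'
  obtain ⟨γ, c1, c2, c3, c4, c5⟩ := jm_glue (G := G) (m := m) (h := h) (B := B) F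
    (by
      intro i hi
      interval_cases i
      · exact hf
      · exact up hg
      · exact (up hg').rev
      · exact hf'.rev)
    (by
      intro i hi
      interval_cases i
      · exact hg0.symm
      · simp [F, hg1, hg1']
      · simp [F, hg0']
      · simp [F, hf0'])
  exact ⟨γ, c1, c2.trans hf0, c3, c4, c5⟩
end
end
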